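/- For every bimodular lattice L, d_+(L) + d_−(L) ≤ 0, where d_±(L) are the two defects of L. -/

import Mathlib

open scoped RealInnerProductSpace

noncomputable section

/-- The dual of a subset of Euclidean space: vectors pairing integrally with everything. -/
def dualSet {n : ℕ} (Λ : Set (EuclideanSpace ℝ (Fin n))) : Set (EuclideanSpace ℝ (Fin n)) :=
  {x | ∀ v ∈ Λ, ∃ k : ℤ, ⟪x, v⟫ = (k : ℝ)}

/-- A (positive definite integral) lattice of full rank `n` in `ℝ^n`: an additive subgroup,
free abelian of rank `n` (it has a `ℤ`-basis indexed by `Fin n`), spanning `ℝ^n` over `ℝ`,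
with all pairwise inner products integral. -/
def IsLattice {n : ℕ} (Λ : Set (EuclideanSpace ℝ (Fin n))) : Prop :=
  (0 ∈ Λ ∧ (∀ x ∈ Λ, ∀ y ∈ Λ, x + y ∈ Λ) ∧ (∀ x ∈ Λ, -x ∈ Λ)) ∧
  (∃ b : Fin n → EuclideanSpace ℝ (Fin n),
      (∀ i, b i ∈ Λ) ∧ LinearIndependent ℤ b ∧
      ∀ x ∈ Λ, ∃ c : Fin n → ℤ, x = ∑ i, (c i : ℝ) • b i) ∧
  Submodule.span ℝ Λ = ⊤ ∧
  ∀ v ∈ Λ, ∀ w ∈ Λ, ∃ k : ℤ, ⟪v, w⟫ = (k : ℝ)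

/-- A unimodular lattice: a lattice equal to its own dual. -/
def IsUnimodular {n : ℕ} (Λ : Set (EuclideanSpace ℝ (Fin n))) : Prop :=
  IsLattice Λ ∧ dualSet Λ = Λ

/-- A bimodular lattice: a lattice of index 2 in its dual. -/
def IsBimodular {n : ℕ} (Λ : Set (EuclideanSpace ℝ (Fin n))) : Prop :=
  IsLattice Λ ∧
  ∃ w ∈ dualSet Λ \ Λ, ∀ x ∈ dualSet Λ, x ∈ Λ ∨ x - w ∈ Λ

/-- Characteristic covectors: elements `ξ` of the dual with `ξ·v ≡ v·v (mod 2)` for all `v ∈ Λ`. -/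
def CharSet {n : ℕ} (Λ : Set (EuclideanSpace ℝ (Fin n))) : Set (EuclideanSpace ℝ (Fin n)) :=
  {ξ | ξ ∈ dualSet Λ ∧ ∀ v ∈ Λ, ∃ k : ℤ, ⟪ξ, v⟫ - ⟪v, v⟫ = 2 * (k : ℝ)}

/-- `CharSign Λ ε` (for `ε = ±1`): characteristic covectors with `ξ·ξ ≡ n + ε (mod 8)`. -/
def CharSign {n : ℕ} (Λ : Set (EuclideanSpace ℝ (Fin n))) (ε : ℤ) :
    Set (EuclideanSpace ℝ (Fin n)) :=
  {ξ | ξ ∈ CharSet Λ ∧ ∃ k : ℤ, ⟪ξ, ξ⟫ = (n : ℝ) + (ε : ℝ) + 8 * (k : ℝ)}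

/-- The defect `d(Λ) = min_{ξ ∈ Char(Λ)} (ξ·ξ − n)/4` of a full-rank lattice in `ℝ^n`. -/
def defect {n : ℕ} (Λ : Set (EuclideanSpace ℝ (Fin n))) : ℝ :=
  sInf ((fun ξ => (⟪ξ, ξ⟫ - (n : ℝ)) / 4) '' CharSet Λ)

/-- The two defects `d_±(L) = min_{ξ ∈ Char_±(L)} (ξ·ξ − n)/4` of a bimodular lattice. -/
def defectSign {n : ℕ} (Λ : Set (EuclideanSpace ℝ (Fin n))) (ε : ℤ) : ℝ :=
  sInf ((fun ξ => (⟪ξ, ξ⟫ - (n : ℝ)) / 4) '' CharSign Λ ε)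

/-- The juxtaposition `(x, y) ∈ ℝ^n × ℝ^m = ℝ^{n+m}`. -/
def pairE {n m : ℕ} (x : EuclideanSpace ℝ (Fin n)) (y : EuclideanSpace ℝ (Fin m)) :
    EuclideanSpace ℝ (Fin (n + m)) :=
  (EuclideanSpace.equiv (Fin (n + m)) ℝ).symm
    (Fin.append (EuclideanSpace.equiv (Fin n) ℝ x) (EuclideanSpace.equiv (Fin m) ℝ y))

/-- The first component `ℝ^{n+m} → ℝ^n` of a covector. -/
def restFst {n m : ℕ} (ξ : EuclideanSpace ℝ (Fin (n + m))) : EuclideanSpace ℝ (Fin n) :=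
  (EuclideanSpace.equiv (Fin n) ℝ).symm
    (fun i => EuclideanSpace.equiv (Fin (n + m)) ℝ ξ (Fin.castAdd m i))

/-- The second component `ℝ^{n+m} → ℝ^m` of a covector. -/
def restSnd {n m : ℕ} (ξ : EuclideanSpace ℝ (Fin (n + m))) : EuclideanSpace ℝ (Fin m) :=
  (EuclideanSpace.equiv (Fin m) ℝ).symm
    (fun i => EuclideanSpace.equiv (Fin (n + m)) ℝ ξ (Fin.natAdd n i))

/-- The orthogonal direct sum `L ⊕ A ⊂ ℝ^{n+m}`, i.e. the subgroup `L × A`. -/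
def prodSet {n m : ℕ} (L : Set (EuclideanSpace ℝ (Fin n))) (A : Set (EuclideanSpace ℝ (Fin m))) :
    Set (EuclideanSpace ℝ (Fin (n + m))) :=
  {z | ∃ x ∈ L, ∃ y ∈ A, z = pairE x y}

/-- The overlattice `U_A = (L × A) ∪ ((L' \ L) × (A' \ A)) ⊂ ℝ^{n+m}`. -/
def overLattice {n m : ℕ} (L : Set (EuclideanSpace ℝ (Fin n)))
    (A : Set (EuclideanSpace ℝ (Fin m))) : Set (EuclideanSpace ℝ (Fin (n + m))) :=
  prodSet L A ∪ prodSet (dualSet L \ L) (dualSet A \ A)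

/-- The standard lattice `I^n = ℤ^n ⊂ ℝ^n`. -/
def stdLattice (n : ℕ) : Set (EuclideanSpace ℝ (Fin n)) :=
  {x | ∀ i : Fin n, ∃ k : ℤ, x i = (k : ℝ)}

/-- A lattice is diagonal if it admits a `ℤ`-basis with Gram matrix `diag(1, …, 1, 2)`,
i.e. it is isomorphic to `Δ_n = I^{n-1} ⊕ A_1`. -/
def IsDiagonal {n : ℕ} (Λ : Set (EuclideanSpace ℝ (Fin n))) : Prop :=
  ∃ b : Fin n → EuclideanSpace ℝ (Fin n),
    (∀ i, b i ∈ Λ) ∧ LinearIndependent ℤ b ∧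
    (∀ x ∈ Λ, ∃ c : Fin n → ℤ, x = ∑ i, (c i : ℝ) • b i) ∧
    (∀ i j : Fin n, ⟪b i, b j⟫ =
      if i = j then (if (i : ℕ) = n - 1 then 2 else 1) else 0)

/-- A lattice has an orthonormal `ℤ`-basis iff it is isomorphic to the standard lattice `I^n`. -/
def HasOrthonormalZBasis {n : ℕ} (Λ : Set (EuclideanSpace ℝ (Fin n))) : Prop :=
  ∃ b : Fin n → EuclideanSpace ℝ (Fin n),
    (∀ i, b i ∈ Λ) ∧ LinearIndependent ℤ b ∧
    (∀ x ∈ Λ, ∃ c : Fin n → ℤ, x = ∑ i, (c i : ℝ) • b i) ∧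
    (∀ i j : Fin n, ⟪b i, b j⟫ = if i = j then 1 else 0)

section
open MeasureTheory
variable {ι : Type*} [Fintype ι]

def intVec (m : ι → ℤ) : ι → ℝ := fun i => (m i : ℝ)

def torusMk (t : ι → ℝ) : UnitAddTorus ι := fun i => (t i : UnitAddCircle)

theorem isOpenQuotientMap_torusMk : IsOpenQuotientMap (torusMk (ι := ι)) where
  surjective x := by
    choose t ht using fun i => QuotientAddGroup.mk_surjective (x i)
    exact ⟨t, funext ht⟩
  continuous := continuous_pi fun i => (AddCircle.continuous_mk' 1).comp (continuous_apply i)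
  isOpenMap := by
    refine IsOpenMap.piMap (fun i => QuotientAddGroup.isOpenMap_coe) ?_
    simp

omit [Fintype ι] in
theorem torusMk_eq_iff {s t : ι → ℝ} : torusMk s = torusMk t ↔ ∃ m : ι → ℤ, t = s + intVec m := by
  constructor
  · intro h
    have h' (i : ι) : ∃ k : ℤ, t i = s i + k := by
      have := congrFun h i
      simp only [torusMk] at this
      rw [eq_comm, ← sub_eq_zero, ← AddCircle.coe_sub, AddCircle.coe_eq_zero_iff] at this
      obtain ⟨k, hk⟩ := this
      exact ⟨k, by simp at hk; linarith⟩
    choose m hm using h'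
    exact ⟨m, funext hm⟩
  · rintro ⟨m, rfl⟩
    funext i
    simp [torusMk, intVec]

omit [Fintype ι] in
theorem torusMk_add_intVec (t : ι → ℝ) (m : ι → ℤ) : torusMk (t + intVec m) = torusMk t :=
  (torusMk_eq_iff.mpr ⟨m, rfl⟩).symm

theorem mFourier_torusMk (k : ι → ℤ) (t : ι → ℝ) :
    UnitAddTorus.mFourier k (torusMk t) =
      Complex.exp (2 * Real.pi * Complex.I * ∑ i, (k i : ℂ) * (t i : ℂ)) := by
  simp only [UnitAddTorus.mFourier, torusMk, ContinuousMap.coe_mk, Finset.mul_sum,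
    Complex.exp_sum]
  refine Finset.prod_congr rfl fun i _ => ?_
  rw [fourier_coe_apply]
  congr 1
  push_cast
  ring

theorem norm_mFourier_apply (k : ι → ℤ) (x : UnitAddTorus ι) :
    ‖UnitAddTorus.mFourier k x‖ = 1 := by
  simp only [UnitAddTorus.mFourier, ContinuousMap.coe_mk, norm_prod, fourier_apply]
  exact Finset.prod_eq_one fun i _ => Circle.norm_coe _

/-- Unfolding of an integral over `ι → ℝ` into a sum of integrals over the unit cube. -/
theorem integral_eq_tsum_integral_cube {h : (ι → ℝ) → ℂ} (hintegrable : Integrable h) :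
    ∫ t, h t = ∑' m : ι → ℤ, ∫ t in Set.univ.pi fun _ => Set.Ico (0 : ℝ) 1, h (t + intVec m) := by
  classical
  let e := ((Pi.basisFun ℝ ι).restrictScalars ℤ).equivFun
  let e' : (ι → ℤ) ≃ (Submodule.span ℤ (Set.range (Pi.basisFun ℝ ι))).toAddSubgroup :=
    e.symm.toEquiv
  have : Countable (Submodule.span ℤ (Set.range (Pi.basisFun ℝ ι))).toAddSubgroup :=
    e'.symm.injective.countable
  have key := (ZSpan.isAddFundamentalDomain' (Pi.basisFun ℝ ι) volume).integral_eq_tsum'' h hintegrable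
  rw [key, ZSpan.fundamentalDomain_pi_basisFun, ← e'.tsum_eq]
  refine tsum_congr fun m => ?_
  refine integral_congr_ae (Filter.Eventually.of_forall fun t => ?_)
  have : ((e.symm m : Submodule.span ℤ (Set.range (Pi.basisFun ℝ ι))) : ι → ℝ) = intVec m := by
    simp only [e, Module.Basis.equivFun_symm_apply, Submodule.coe_sum, Submodule.coe_smul,
      Module.Basis.restrictScalars_apply]
    ext i
    simp [intVec, Pi.single_apply]
  show h (((e.symm m : Submodule.span ℤ (Set.range (Pi.basisFun ℝ ι))) : ι → ℝ) + t) = _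
  rw [this, add_comm]

/-- Poisson summation on `ι → ℝ`. -/
theorem poisson_summation_pi {g : (ι → ℝ) → ℂ} (hg : Continuous g) (hintegrable : Integrable g)
    (hbound : ∀ R : ℝ, ∃ u : (ι → ℤ) → ℝ, Summable u ∧
      ∀ t : ι → ℝ, ‖t‖ < R → ∀ m, ‖g (t + intVec m)‖ ≤ u m)
    (hsum : Summable fun k : ι → ℤ => ∫ t, UnitAddTorus.mFourier (-k) (torusMk t) * g t)
    (t : ι → ℝ) :
    ∑' m : ι → ℤ, g (t + intVec m) =
      ∑' k : ι → ℤ, (∫ s, UnitAddTorus.mFourier (-k) (torusMk s) * g s) *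
        UnitAddTorus.mFourier k (torusMk t) := by
  let G : (ι → ℝ) → ℂ := fun s => ∑' m : ι → ℤ, g (s + intVec m)
  have hGper (s : ι → ℝ) (m : ι → ℤ) : G (s + intVec m) = G s := by
    simp only [G]
    rw [← (Equiv.addLeft m).tsum_eq fun k => g (s + intVec k)]
    refine tsum_congr fun k => congrArg g ?_
    ext i
    simp [intVec, add_assoc]
  have hGcont : Continuous G := by
    rw [continuous_iff_continuousAt]
    intro s
    obtain ⟨u, hu, hub⟩ := hbound (‖s‖ + 1)
    have : ContinuousOn G (Metric.ball 0 (‖s‖ + 1)) := by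
      refine continuousOn_tsum (fun m => ?_) hu fun m x hx => hub x (by simpa using hx) m
      exact (hg.comp (continuous_id.add continuous_const)).continuousOn
    exact this.continuousAt (Metric.isOpen_ball.mem_nhds (by simp))
  have hq := isOpenQuotientMap_torusMk (ι := ι)
  let sec := Function.surjInv hq.surjective
  have hlift (s : ι → ℝ) : G (sec (torusMk s)) = G s := by
    obtain ⟨m, hm⟩ := torusMk_eq_iff.mp (Function.surjInv_eq hq.surjective (torusMk s))
    calc G (sec (torusMk s)) = G (sec (torusMk s) + intVec m) := (hGper _ _).symm
      _ = G s := (congrArg G hm).symm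
  let F : C(UnitAddTorus ι, ℂ) :=
    ⟨fun x => G (sec x), by
      rw [hq.isQuotientMap.continuous_iff]
      exact hGcont.congr fun s => (hlift s).symm⟩
  have hF (s : ι → ℝ) : F (torusMk s) = G s := hlift s
  have hcoeff (k : ι → ℤ) : UnitAddTorus.mFourierCoeff F k =
      ∫ s, UnitAddTorus.mFourier (-k) (torusMk s) * g s := by
    have hcontk : Continuous fun s : ι → ℝ => UnitAddTorus.mFourier (-k) (torusMk s) :=
      (UnitAddTorus.mFourier (-k)).continuous.comp hq.continuous
    have hintk : Integrable fun s => UnitAddTorus.mFourier (-k) (torusMk s) * g s := by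
      refine hintegrable.bdd_mul (c := 1) hcontk.aestronglyMeasurable ?_
      exact Filter.Eventually.of_forall fun s => (norm_mFourier_apply _ _).le
    rw [UnitAddTorus.mFourierCoeff_eq_integral F k 0, integral_eq_tsum_integral_cube hintk]
    obtain ⟨u, hu, hub⟩ := hbound 2
    set Q : Set (ι → ℝ) := Set.univ.pi fun _ => Set.Ico (0 : ℝ) 1 with hQ
    have hset : {x : ι → ℝ | ∀ i, x i ∈ Set.Ioc ((0 : ι → ℝ) i) ((0 : ι → ℝ) i + 1)} =ᵐ[volume]
        Q := by
      have h1 := Measure.univ_pi_Ioc_ae_eq_Icc (μ := fun _ : ι => (volume : Measure ℝ))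
        (f := 0) (g := 1)
      have h2 := Measure.univ_pi_Ico_ae_eq_Icc (μ := fun _ : ι => (volume : Measure ℝ))
        (f := 0) (g := 1)
      refine Filter.EventuallyEq.trans ?_ (h1.trans h2.symm)
      refine Filter.EventuallyEq.of_eq ?_
      have : {x : ι → ℝ | ∀ i, x i ∈ Set.Ioc ((0 : ι → ℝ) i) ((0 : ι → ℝ) i + 1)} =
          Set.univ.pi fun i => Set.Ioc ((0 : ι → ℝ) i) ((1 : ι → ℝ) i) := by
        ext x
        simp
      exact this
    have hQm : MeasurableSet Q := MeasurableSet.univ_pi fun _ => measurableSet_Ico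
    have hQvol : volume Q ≠ ⊤ := by
      rw [hQ, show (Set.univ.pi fun _ : ι => Set.Ico (0 : ℝ) 1) =
        Set.univ.pi fun i : ι => Set.Ico ((0 : ι → ℝ) i) ((1 : ι → ℝ) i) from rfl,
        Real.volume_pi_Ico]
      simp
    have hnorm (m : ι → ℤ) (s : ι → ℝ) (hs : s ∈ Q) :
        ‖UnitAddTorus.mFourier (-k) (torusMk (s + intVec m)) * g (s + intVec m)‖ ≤ u m := by
      rw [norm_mul, norm_mFourier_apply, one_mul]
      refine hub s (lt_of_le_of_lt ?_ one_lt_two) m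
      refine (pi_norm_le_iff_of_nonneg zero_le_one).mpr fun i => ?_
      have := hs i (Set.mem_univ i)
      rw [Real.norm_eq_abs, abs_of_nonneg this.1]
      exact this.2.le
    have hcontm (m : ι → ℤ) : Continuous fun s : ι → ℝ =>
        UnitAddTorus.mFourier (-k) (torusMk (s + intVec m)) * g (s + intVec m) :=
      (hcontk.mul hg).comp (continuous_id.add continuous_const)
    have hintm (m : ι → ℤ) : IntegrableOn (fun s : ι → ℝ =>
        UnitAddTorus.mFourier (-k) (torusMk (s + intVec m)) * g (s + intVec m)) Q volume :=
      Measure.integrableOn_of_bounded hQvol (hcontm m).aestronglyMeasurable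
        ((ae_restrict_iff' hQm).mpr (Filter.Eventually.of_forall fun s hs => hnorm m s hs))
    rw [setIntegral_congr_set hset, (hasSum_integral_of_summable_integral_norm hintm ?_).tsum_eq]
    · refine integral_congr_ae (Filter.Eventually.of_forall fun s => ?_)
      show UnitAddTorus.mFourier (-k) (torusMk s) • F (torusMk s) = _
      simp only [hF, torusMk_add_intVec, tsum_mul_left, smul_eq_mul, G]
    · refine Summable.of_nonneg_of_le (fun m => integral_nonneg fun s => norm_nonneg _)
        (fun m => ?_) (hu.mul_right (volume.real Q))
      have := norm_setIntegral_le_of_norm_le_const (μ := volume) (s := Q) (C := u m)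
        (f := fun s => ‖UnitAddTorus.mFourier (-k) (torusMk (s + intVec m)) * g (s + intVec m)‖)
        (lt_top_iff_ne_top.mpr hQvol) (fun s hs => by simpa using hnorm m s hs)
      exact (le_abs_self _).trans this
  have hsum' : Summable (UnitAddTorus.mFourierCoeff F) := by
    rw [show UnitAddTorus.mFourierCoeff F = fun k => ∫ s, UnitAddTorus.mFourier (-k) (torusMk s) * g s
      from funext hcoeff]
    exact hsum
  have := (UnitAddTorus.hasSum_mFourier_series_apply_of_summable hsum' (torusMk t)).tsum_eq
  rw [hF] at this
  simp only [hcoeff, smul_eq_mul] at this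
  exact this.symm
end

section
open MeasureTheory
variable {ι : Type*} [Fintype ι] {E : Type*} [NormedAddCommGroup E] [InnerProductSpace ℝ E]

/-- The lattice point with integer coordinates `m` in the basis `b`. -/
def latPt (b : Module.Basis ι ℝ E) (m : ι → ℤ) : E := b.equivFun.symm (intVec m)

theorem latPt_add (b : Module.Basis ι ℝ E) (m k : ι → ℤ) :
    latPt b (m + k) = latPt b m + latPt b k := by
  rw [latPt, latPt, latPt, ← map_add]
  congr 1
  ext i
  simp [intVec]

theorem latPt_zero (b : Module.Basis ι ℝ E) : latPt b 0 = 0 := by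
  have := latPt_add b 0 0
  simpa using this

theorem latPt_injective (b : Module.Basis ι ℝ E) : Function.Injective (latPt b) := by
  intro m k h
  have := b.equivFun.symm.injective h
  funext i
  simpa [intVec] using congrFun this i

theorem latPt_eq_sum (b : Module.Basis ι ℝ E) (m : ι → ℤ) :
    latPt b m = ∑ i, (m i : ℝ) • b i := by
  simp [latPt, Module.Basis.equivFun_symm_apply, intVec]

theorem latPt_mem_span (b : Module.Basis ι ℝ E) (m : ι → ℤ) :
    latPt b m ∈ Submodule.span ℤ (Set.range b) := by
  rw [latPt_eq_sum]
  refine Submodule.sum_mem _ fun i _ => ?_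
  rw [Int.cast_smul_eq_zsmul]
  exact Submodule.smul_mem _ _ (Submodule.subset_span ⟨i, rfl⟩)

variable [FiniteDimensional ℝ E]

theorem summable_exp_neg_norm_latPt_sq (b : Module.Basis ι ℝ E) {c : ℝ} (hc : 0 < c) :
    Summable fun m : ι → ℤ => Real.exp (-c * ‖latPt b m‖ ^ 2) := by
  set L := Submodule.span ℤ (Set.range b) with hL
  let j : (ι → ℤ) → L := fun m => ⟨latPt b m, latPt_mem_span b m⟩
  have hj : Function.Injective j := fun m k h => latPt_injective b (congrArg Subtype.val h)
  set d := Module.finrank ℤ L + 1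
  have h1 := ((ZLattice.summable_norm_pow_inv L (2 * d) (by omega)).comp_injective hj)
  have h2 : Summable fun m : ι → ℤ => if m = 0 then (1 : ℝ) else 0 := by
    classical
    exact summable_of_ne_finset_zero (s := {0}) (by simp +contextual)
  refine Summable.of_nonneg_of_le (fun _ => (Real.exp_pos _).le) (fun m => ?_)
    ((h1.mul_left (d.factorial * c⁻¹ ^ d)).add h2)
  by_cases hm : m = 0
  · subst hm
    simp only [latPt_zero, norm_zero, if_true]
    have : 0 ≤ (d.factorial : ℝ) * c⁻¹ ^ d *
      ((fun z : L => (‖z‖⁻¹ ^ (2 * d))) ∘ j) 0 := by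
      simp only [Function.comp]
      positivity
    simp only [Function.comp] at this ⊢
    norm_num
    simpa using this
  · have hr : 0 < ‖latPt b m‖ := by
      rw [norm_pos_iff]
      intro h
      exact hm (latPt_injective b (h.trans (latPt_zero b).symm))
    simp only [if_neg hm, add_zero, Function.comp]
    change _ ≤ d.factorial * c⁻¹ ^ d * ‖latPt b m‖⁻¹ ^ (2 * d)
    set r := ‖latPt b m‖
    have hx : 0 < c * r ^ 2 := by positivity
    have := Real.pow_div_factorial_le_exp (c * r ^ 2) hx.le d
    rw [neg_mul, Real.exp_neg]
    calc (Real.exp (c * r ^ 2))⁻¹ ≤ ((c * r ^ 2) ^ d / d.factorial)⁻¹ := by gcongr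
      _ = _ := by
        simp only [div_eq_mul_inv, inv_pow, mul_pow, mul_inv, inv_inv, pow_mul]
        ring

omit [InnerProductSpace ℝ E] [FiniteDimensional ℝ E] in
theorem norm_sq_half_sub_le (x z : E) : ‖z‖ ^ 2 / 2 - ‖x‖ ^ 2 ≤ ‖z + x‖ ^ 2 := by
  have h : ‖z‖ ≤ ‖z + x‖ + ‖x‖ := by simpa using norm_sub_le (z + x) x
  nlinarith [norm_nonneg z, norm_nonneg x, norm_nonneg (z + x), sq_nonneg (‖z + x‖ - ‖x‖)]

omit [InnerProductSpace ℝ E] [FiniteDimensional ℝ E] in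
theorem exp_neg_norm_add_sq_le {c R : ℝ} (hc : 0 ≤ c) {x : E} (hx : ‖x‖ ≤ R) (z : E) :
    Real.exp (-c * ‖z + x‖ ^ 2) ≤ Real.exp (c * R ^ 2) * Real.exp (-(c / 2) * ‖z‖ ^ 2) := by
  rw [← Real.exp_add, Real.exp_le_exp]
  have h1 := norm_sq_half_sub_le x z
  have h2 : ‖x‖ ^ 2 ≤ R ^ 2 := by gcongr
  nlinarith

theorem summable_exp_neg_norm_latPt_add_sq (b : Module.Basis ι ℝ E) {c : ℝ} (hc : 0 < c) (a : E) :
    Summable fun m : ι → ℤ => Real.exp (-c * ‖latPt b m + a‖ ^ 2) :=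
  Summable.of_nonneg_of_le (fun _ => (Real.exp_pos _).le)
    (fun m => exp_neg_norm_add_sq_le hc.le le_rfl (latPt b m))
    ((summable_exp_neg_norm_latPt_sq b (half_pos hc)).mul_left _)
end

section
open MeasureTheory
variable {ι : Type*} [Fintype ι] {E : Type*} [NormedAddCommGroup E] [InnerProductSpace ℝ E]

/-- The lattice spanned by the basis `b` coincides with its dual. -/
def IsSelfDualBasis (b : Module.Basis ι ℝ E) : Prop :=
  ∀ x, (∃ m, latPt b m = x) ↔ ∀ i, ∃ k : ℤ, ⟪x, b i⟫ = (k : ℝ)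

theorem inner_equivFun_symm (b : Module.Basis ι ℝ E) (x : E) (t : ι → ℝ) :
    ⟪x, b.equivFun.symm t⟫ = ∑ i, t i * ⟪x, b i⟫ := by
  rw [Module.Basis.equivFun_symm_apply, inner_sum]
  exact Finset.sum_congr rfl fun i _ => real_inner_smul_right _ _ _

theorem ext_inner_basis (b : Module.Basis ι ℝ E) {x y : E} (h : ∀ i, ⟪x, b i⟫ = ⟪y, b i⟫) :
    x = y := by
  refine ext_inner_right ℝ fun v => ?_
  rw [← b.equivFun.symm_apply_apply v, inner_equivFun_symm, inner_equivFun_symm]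
  simp [h]

variable [FiniteDimensional ℝ E]

omit [Fintype ι] in
theorem exists_inner_basis_eq (b : Module.Basis ι ℝ E) (c : ι → ℝ) : ∃ x : E, ∀ i, ⟪x, b i⟫ = c i := by
  refine ⟨(InnerProductSpace.toDual ℝ E).symm (LinearMap.toContinuousLinearMap (b.constr ℝ c)),
    fun i => ?_⟩
  rw [InnerProductSpace.toDual_symm_apply]
  exact b.constr_basis ℝ c i

/-- Reindexing of a self-dual lattice by its coordinates in the dual basis. -/
theorem IsSelfDualBasis.exists_equiv {b : Module.Basis ι ℝ E} (hb : IsSelfDualBasis b) :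
    ∃ σ : (ι → ℤ) ≃ (ι → ℤ), ∀ k i, ⟪latPt b (σ k), b i⟫ = (k i : ℝ) := by
  have h (k : ι → ℤ) : ∃ m : ι → ℤ, ∀ i, ⟪latPt b m, b i⟫ = (k i : ℝ) := by
    obtain ⟨x, hx⟩ := exists_inner_basis_eq b fun i => (k i : ℝ)
    obtain ⟨m, rfl⟩ := (hb x).mpr fun i => ⟨k i, hx i⟩
    exact ⟨m, hx⟩
  choose σ hσ using h
  refine ⟨Equiv.ofBijective σ ⟨fun k l hkl => ?_, fun m => ?_⟩, hσ⟩
  · funext i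
    have h1 := hσ k i
    rw [hkl, hσ l i] at h1
    exact_mod_cast h1.symm
  · choose k hk using (hb (latPt b m)).mp ⟨m, rfl⟩
    exact ⟨k, latPt_injective b (ext_inner_basis b fun i => (hσ k i).trans (hk i).symm)⟩

/-- The theta series of the lattice spanned by `b`, translated by `a`. -/
def latTheta (b : Module.Basis ι ℝ E) (a : E) (z : ℂ) : ℂ :=
  ∑' m : ι → ℤ, Complex.exp (Real.pi * Complex.I * z * ‖latPt b m + a‖ ^ 2)

omit [Fintype ι] [InnerProductSpace ℝ E] [FiniteDimensional ℝ E] in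
theorem norm_cexp_pi_I_mul (z : ℂ) (x : E) :
    ‖Complex.exp (Real.pi * Complex.I * z * ‖x‖ ^ 2)‖ =
      Real.exp (-(Real.pi * z.im) * ‖x‖ ^ 2) := by
  rw [Complex.norm_exp]
  congr 1
  rw [← Complex.ofReal_pow, Complex.re_mul_ofReal]
  simp

section
variable [MeasurableSpace E] [BorelSpace E]

theorem exists_integral_basis_eq (b : Module.Basis ι ℝ E) :
    ∃ c : ℝ, ∀ F : E → ℂ, (Integrable F → Integrable fun t => F (b.equivFun.symm t)) ∧
      ∫ t, F (b.equivFun.symm t) = c * ∫ x, F x := by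
  let e : (ι → ℝ) ≃L[ℝ] E := b.equivFunL.symm
  let e' : (ι → ℝ) ≃ᵐ E := e.toHomeomorph.toMeasurableEquiv
  obtain ⟨κ, hκ⟩ : ∃ κ : NNReal, Measure.map e' volume = κ • (volume : Measure E) := by
    have : (Measure.map e volume).IsAddHaarMeasure := inferInstance
    exact ⟨_, Measure.isAddLeftInvariant_eq_smul (Measure.map e volume) volume⟩
  refine ⟨κ, fun F => ⟨fun hF => ?_, ?_⟩⟩
  · refine (integrable_map_equiv e' F).mp ?_
    rw [hκ]
    exact hF.smul_measure_nnreal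
  · have h1 : ∫ t, F (b.equivFun.symm t) = ∫ x, F x ∂(Measure.map e' volume) :=
      (MeasureTheory.integral_map_equiv e' F).symm
    rw [h1, hκ, integral_smul_nnreal_measure]
    rfl

theorem integral_fourier_gaussian_shift (a d : E) {z : ℂ} (hz : 0 < z.im) :
    ∫ x : E, Complex.exp (2 * Real.pi * Complex.I * (-⟪d, x⟫ : ℝ)) *
        Complex.exp (Real.pi * Complex.I * z * ‖x + a‖ ^ 2) =
      (Complex.I / z) ^ (Module.finrank ℝ E / 2 : ℂ) *
        Complex.exp (Real.pi * Complex.I * (-1 / z) * ‖d‖ ^ 2) *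
        Complex.exp (2 * Real.pi * Complex.I * (⟪d, a⟫ : ℝ)) := by
  have hz0 : z ≠ 0 := by rintro rfl; simp at hz
  have hpi : (Real.pi : ℂ) ≠ 0 := by exact_mod_cast Real.pi_ne_zero
  have hb : 0 < (-(Real.pi * Complex.I * z)).re := by
    simp
    positivity
  have h := fourier_gaussian_innerProductSpace hb d
  rw [Real.fourier_eq'] at h
  rw [← integral_sub_right_eq_self _ a]
  have h2 : (Real.pi / -(Real.pi * Complex.I * z) : ℂ) = Complex.I / z := by
    field_simp
    simp
  have h3 : (-Real.pi ^ 2 * ‖d‖ ^ 2 / -(Real.pi * Complex.I * z) : ℂ) =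
      Real.pi * Complex.I * (-1 / z) * ‖d‖ ^ 2 := by
    field_simp
    simp
  rw [h2, h3] at h
  rw [← h, ← integral_mul_const]
  refine integral_congr_ae (Filter.Eventually.of_forall fun x => ?_)
  simp only [sub_add_cancel, smul_eq_mul, neg_neg, ← Complex.exp_add, inner_sub_right]
  congr 1
  rw [real_inner_comm]
  push_cast
  ring
end

end

section
open MeasureTheory
variable {ι : Type*} [Fintype ι] {E : Type*} [NormedAddCommGroup E] [InnerProductSpace ℝ E]
variable [FiniteDimensional ℝ E]

theorem IsSelfDualBasis.exists_latTheta_eq {b : Module.Basis ι ℝ E} (hb : IsSelfDualBasis b) :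
    ∃ c : ℝ, ∀ (a : E) (z : ℂ), 0 < z.im → latTheta b a z =
      c * ((Complex.I / z) ^ (Module.finrank ℝ E / 2 : ℂ) *
        ∑' m : ι → ℤ, Complex.exp (Real.pi * Complex.I * (-1 / z) * ‖latPt b m‖ ^ 2) *
          Complex.exp (2 * Real.pi * Complex.I * (⟪latPt b m, a⟫ : ℝ))) := by
  let : MeasurableSpace E := borel E
  have : BorelSpace E := ⟨rfl⟩
  obtain ⟨c, hc⟩ := exists_integral_basis_eq b
  obtain ⟨σ, hσ⟩ := hb.exists_equiv
  refine ⟨c, fun a z hz => ?_⟩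
  have hz' : 0 < (-1 / z).im := by
    have hz0 : z ≠ 0 := by rintro rfl; simp at hz
    rw [neg_div, Complex.neg_im, one_div, Complex.inv_im, neg_div, neg_neg]
    exact div_pos hz (Complex.normSq_pos.mpr hz0)
  let φ : (ι → ℝ) ≃L[ℝ] E := b.equivFunL.symm
  have hφ (t : ι → ℝ) : φ t = b.equivFun.symm t := rfl
  let g : (ι → ℝ) → ℂ := fun t => Complex.exp (Real.pi * Complex.I * z * ‖φ t + a‖ ^ 2)
  have hgn (t : ι → ℝ) : ‖g t‖ = Real.exp (-(Real.pi * z.im) * ‖φ t + a‖ ^ 2) :=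
    norm_cexp_pi_I_mul z _
  have hg : Continuous g := by
    have := φ.continuous
    fun_prop
  have hcoeff (k : ι → ℤ) : ∫ t, UnitAddTorus.mFourier (-k) (torusMk t) * g t =
      c * ((Complex.I / z) ^ (Module.finrank ℝ E / 2 : ℂ) *
        (Complex.exp (Real.pi * Complex.I * (-1 / z) * ‖latPt b (σ k)‖ ^ 2) *
          Complex.exp (2 * Real.pi * Complex.I * (⟪latPt b (σ k), a⟫ : ℝ)))) := by
    rw [← mul_assoc (_ ^ _), ← integral_fourier_gaussian_shift a _ hz, ← (hc _).2]
    refine integral_congr_ae (Filter.Eventually.of_forall fun t => ?_)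
    simp only [mFourier_torusMk, inner_equivFun_symm, hσ, g, hφ]
    congr 3
    push_cast
    rw [← Finset.sum_neg_distrib]
    refine Finset.sum_congr rfl fun i _ => ?_
    simp only [Pi.neg_apply]
    push_cast
    ring
  have hdual : Summable fun m : ι → ℤ =>
      Complex.exp (Real.pi * Complex.I * (-1 / z) * ‖latPt b m‖ ^ 2) *
          Complex.exp (2 * Real.pi * Complex.I * (⟪latPt b m, a⟫ : ℝ)) := by
    refine Summable.of_norm ?_
    have (x : ℝ) : ‖Complex.exp (2 * Real.pi * Complex.I * x)‖ = 1 := by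
      rw [show (2 * Real.pi * Complex.I * x : ℂ) = (2 * Real.pi * x : ℝ) * Complex.I by
        push_cast; ring, Complex.norm_exp_ofReal_mul_I]
    simp only [norm_mul, this, mul_one, norm_cexp_pi_I_mul]
    exact summable_exp_neg_norm_latPt_sq b (by positivity)
  have hintegrable : Integrable g := by
    refine (hc fun x => Complex.exp (Real.pi * Complex.I * z * ‖x + a‖ ^ 2)).1 ?_
    have hre : 0 < (-(Real.pi * Complex.I * z)).re := by
      simp
      positivity
    have := (GaussianFourier.integrable_cexp_neg_mul_sq_norm_add hre 0 (0 : E)).comp_add_right a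
    simpa using this
  have hpoisson := poisson_summation_pi hg hintegrable (fun R => ?_) ?_ 0
  · have h0 : torusMk (0 : ι → ℝ) = 0 := by funext i; simp [torusMk]
    simp only [h0, zero_add, hcoeff] at hpoisson
    have h1 (k : ι → ℤ) : UnitAddTorus.mFourier k (0 : UnitAddTorus ι) = 1 := by
      rw [← h0, mFourier_torusMk]; simp
    simp only [h1, mul_one, tsum_mul_left] at hpoisson
    rw [← σ.tsum_eq, ← hpoisson]
    rfl
  · obtain ⟨C, hC0, hC⟩ := φ.toContinuousLinearMap.bound
    refine ⟨fun m => Real.exp (Real.pi * z.im * (C * |R| + ‖a‖) ^ 2) *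
      Real.exp (-(Real.pi * z.im / 2) * ‖latPt b m‖ ^ 2),
      (summable_exp_neg_norm_latPt_sq b (by positivity)).mul_left _, fun t ht m => ?_⟩
    rw [hgn, map_add, add_comm (φ t), add_assoc]
    refine exp_neg_norm_add_sq_le (by positivity) ?_ (latPt b m)
    refine (norm_add_le _ _).trans (add_le_add_left ((hC t).trans ?_) _)
    have : R ≤ |R| := le_abs_self R
    gcongr
    linarith
  · simp only [hcoeff]
    exact (((σ.summable_iff (f := fun m => _)).mpr hdual).mul_left _).mul_left _
end

section
open MeasureTheory
variable {ι : Type*} [Fintype ι] {E : Type*} [NormedAddCommGroup E] [InnerProductSpace ℝ E]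
variable [FiniteDimensional ℝ E]

theorem neg_one_div_im_pos {z : ℂ} (hz : 0 < z.im) : 0 < (-1 / z).im := by
  have hz0 : z ≠ 0 := by rintro rfl; simp at hz
  rw [neg_div, Complex.neg_im, one_div, Complex.inv_im, neg_div, neg_neg]
  exact div_pos hz (Complex.normSq_pos.mpr hz0)

theorem latTheta_I_ne_zero (b : Module.Basis ι ℝ E) (a : E) : latTheta b a Complex.I ≠ 0 := by
  have hs := summable_exp_neg_norm_latPt_add_sq b Real.pi_pos a
  have h : latTheta b a Complex.I =
      ((∑' m : ι → ℤ, Real.exp (-Real.pi * ‖latPt b m + a‖ ^ 2) : ℝ) : ℂ) := by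
    rw [latTheta, Complex.ofReal_tsum]
    refine tsum_congr fun m => ?_
    rw [mul_assoc (Real.pi : ℂ), Complex.I_mul_I]
    push_cast
    ring_nf
  rw [h, Complex.ofReal_ne_zero]
  exact (hs.tsum_pos (fun _ => (Real.exp_pos _).le) 0 (Real.exp_pos _)).ne'

/-- The automorphy factor of the theta series of a self-dual lattice of rank `N`. -/
def thetaFactor (N : ℕ) (z : ℂ) : ℂ := (Complex.I / z) ^ (N / 2 : ℂ)

theorem IsSelfDualBasis.latTheta_eq {b : Module.Basis ι ℝ E} (hb : IsSelfDualBasis b) (a : E)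
    {z : ℂ} (hz : 0 < z.im) : latTheta b a z =
      thetaFactor (Module.finrank ℝ E) z *
        ∑' m : ι → ℤ, Complex.exp (Real.pi * Complex.I * (-1 / z) * ‖latPt b m‖ ^ 2) *
          Complex.exp (2 * Real.pi * Complex.I * (⟪latPt b m, a⟫ : ℝ)) := by
  obtain ⟨c, hc⟩ := hb.exists_latTheta_eq
  have h1 := hc 0 Complex.I (by simp)
  have hI : (-1 / Complex.I) = Complex.I := by
    rw [div_eq_iff Complex.I_ne_zero, Complex.I_mul_I]
  have h0 := latTheta_I_ne_zero b 0
  have h2 : (c : ℂ) = 1 := by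
    rw [hI, div_self Complex.I_ne_zero, Complex.one_cpow, one_mul] at h1
    simp only [inner_zero_right, Complex.ofReal_zero, mul_zero, Complex.exp_zero, mul_one] at h1
    have h3 : latTheta b 0 Complex.I = c * latTheta b 0 Complex.I := by
      conv_rhs => rw [latTheta]
      simpa using h1
    exact mul_right_cancel₀ h0 (by rw [← h3, one_mul])
  rw [hc a z hz, h2, one_mul, thetaFactor]

theorem IsSelfDualBasis.latTheta_zero {b : Module.Basis ι ℝ E} (hb : IsSelfDualBasis b)
    {z : ℂ} (hz : 0 < z.im) : latTheta b 0 z =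
      thetaFactor (Module.finrank ℝ E) z * latTheta b 0 (-1 / z) := by
  rw [hb.latTheta_eq 0 hz]
  simp [latTheta]

/-- `ξ` is characteristic for the lattice spanned by `b`. -/
def IsCharVec (b : Module.Basis ι ℝ E) (ξ : E) : Prop :=
  ∀ m, ∃ k : ℤ, ⟪latPt b m, ξ⟫ - ‖latPt b m‖ ^ 2 = 2 * (k : ℝ)

/-- The squared norms of the lattice spanned by `b` are integers. -/
def IsIntegralBasis (b : Module.Basis ι ℝ E) : Prop :=
  ∀ m, ∃ k : ℤ, ‖latPt b m‖ ^ 2 = (k : ℝ)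

theorem cexp_pi_I_mul_eq_of_sub_eq {x y : ℝ} {k : ℤ} (h : x - y = 2 * (k : ℝ)) :
    Complex.exp (Real.pi * Complex.I * x) = Complex.exp (Real.pi * Complex.I * y) := by
  rw [Complex.exp_eq_exp_iff_exists_int]
  refine ⟨k, ?_⟩
  have : x = y + 2 * k := by linarith
  rw [this]
  push_cast
  ring

omit [FiniteDimensional ℝ E] in
theorem latTheta_add_two {b : Module.Basis ι ℝ E} (hb : IsIntegralBasis b) (z : ℂ) :
    latTheta b 0 (z + 2) = latTheta b 0 z := by
  refine tsum_congr fun m => ?_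
  obtain ⟨k, hk⟩ := hb m
  rw [add_zero, ← Complex.ofReal_pow, hk, Complex.exp_eq_exp_iff_exists_int]
  exact ⟨k, by push_cast; ring⟩

omit [FiniteDimensional ℝ E] in
theorem latTheta_half_add_one {b : Module.Basis ι ℝ E} (hb : IsIntegralBasis b) {ξ : E} (hξ : IsCharVec b ξ)
    (z : ℂ) : latTheta b ((1 / 2 : ℝ) • ξ) (z + 1) =
      Complex.exp (Real.pi * Complex.I * (‖ξ‖ ^ 2 / 4 : ℝ)) * latTheta b ((1 / 2 : ℝ) • ξ) z := by
  rw [latTheta, latTheta, ← tsum_mul_left]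
  refine tsum_congr fun m => ?_
  obtain ⟨k, hk⟩ := hξ m
  obtain ⟨j, hj⟩ := hb m
  have h1 : ‖latPt b m + (1 / 2 : ℝ) • ξ‖ ^ 2 - ‖ξ‖ ^ 2 / 4 = 2 * ((j + k : ℤ) : ℝ) := by
    rw [norm_add_sq_real, real_inner_smul_right, norm_smul]
    push_cast
    norm_num
    nlinarith
  rw [← cexp_pi_I_mul_eq_of_sub_eq h1, ← Complex.exp_add]
  congr 1
  push_cast
  ring

theorem IsSelfDualBasis.latTheta_half {b : Module.Basis ι ℝ E} (hb : IsSelfDualBasis b)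
    {ξ : E} (hξ : IsCharVec b ξ) {z : ℂ} (hz : 0 < z.im) : latTheta b ((1 / 2 : ℝ) • ξ) z =
      thetaFactor (Module.finrank ℝ E) z * latTheta b 0 (-1 / z + 1) := by
  rw [hb.latTheta_eq _ hz]
  congr 1
  refine tsum_congr fun m => ?_
  obtain ⟨k, hk⟩ := hξ m
  have h : Complex.exp (2 * Real.pi * Complex.I * (⟪latPt b m, (1 / 2 : ℝ) • ξ⟫ : ℝ)) =
      Complex.exp (Real.pi * Complex.I * (‖latPt b m‖ ^ 2 : ℝ)) := by
    rw [← cexp_pi_I_mul_eq_of_sub_eq hk, real_inner_smul_right]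
    congr 1
    push_cast
    ring
  rw [h, ← Complex.exp_add, add_zero]
  congr 1
  push_cast
  ring

theorem thetaFactor_mul (N : ℕ) {z : ℂ} (hz : 0 < z.im) :
    thetaFactor N z * thetaFactor N (-1 / z) = 1 := by
  have hz0 : z ≠ 0 := by rintro rfl; simp at hz
  have h : Complex.I / (-1 / z) = (Complex.I / z)⁻¹ := by
    field_simp
    simp
  have hre : 0 < (Complex.I / z).re := by
    have : Complex.I / z = -Complex.I * (-1 / z) := by ring
    rw [this]
    simpa using neg_one_div_im_pos hz
  have hne : Complex.I / z ≠ 0 := div_ne_zero Complex.I_ne_zero hz0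
  rw [thetaFactor, thetaFactor, h, Complex.inv_cpow, mul_inv_cancel₀]
  · simp [Complex.cpow_eq_zero_iff, hne]
  · intro harg
    rw [Complex.arg_eq_pi_iff] at harg
    linarith [harg.1]

theorem thetaFactor_ne_zero (N : ℕ) {z : ℂ} (hz : 0 < z.im) : thetaFactor N z ≠ 0 :=
  left_ne_zero_of_mul_eq_one (thetaFactor_mul N hz)

theorem IsSelfDualBasis.latTheta_add_one {b : Module.Basis ι ℝ E} (hb : IsSelfDualBasis b)
    {ξ : E} (hξ : IsCharVec b ξ) {z : ℂ} (hz : 0 < z.im) : latTheta b 0 (z + 1) =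
      thetaFactor (Module.finrank ℝ E) z * latTheta b ((1 / 2 : ℝ) • ξ) (-1 / z) := by
  have hz0 : z ≠ 0 := by rintro rfl; simp at hz
  rw [hb.latTheta_half hξ (neg_one_div_im_pos hz), ← mul_assoc, thetaFactor_mul _ hz, one_mul]
  congr 2
  field_simp

theorem thetaFactor_pow (N : ℕ) {z : ℂ} (hz : z ≠ 0) :
    thetaFactor N z ^ 24 = (z ^ (12 * N))⁻¹ := by
  have hne : Complex.I / z ≠ 0 := div_ne_zero Complex.I_ne_zero hz
  rw [thetaFactor, ← Complex.cpow_nat_mul]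
  have : ((24 : ℕ) * (N / 2 : ℂ)) = ((12 * N : ℕ) : ℂ) := by push_cast; ring
  rw [this, Complex.cpow_natCast, div_pow, pow_mul, pow_mul]
  have : Complex.I ^ 12 = 1 := by
    rw [show 12 = 4 * 3 from rfl, pow_mul, Complex.I_pow_four, one_pow]
  rw [this, one_pow, one_div]

theorem IsSelfDualBasis.exists_norm_sq_eq {b : Module.Basis ι ℝ E} (hb : IsSelfDualBasis b)
    (hb' : IsIntegralBasis b) {ξ : E} (hξ : IsCharVec b ξ) :
    ∃ k : ℤ, ‖ξ‖ ^ 2 = Module.finrank ℝ E + 8 * (k : ℝ) := by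
  set N := Module.finrank ℝ E
  set C := latTheta b ((1 / 2 : ℝ) • ξ)
  set A := latTheta b 0
  have hI : (-1 / Complex.I) = Complex.I := by
    rw [div_eq_iff Complex.I_ne_zero, Complex.I_mul_I]
  have hp : (1 + Complex.I) ≠ 0 := by
    intro h
    simpa using congrArg Complex.im h
  have hm : (-1 + Complex.I) ≠ 0 := by
    intro h
    simpa using congrArg Complex.im h
  have h1 : C (Complex.I + 1) = Complex.exp (Real.pi * Complex.I * (‖ξ‖ ^ 2 / 4 : ℝ)) *
      C Complex.I := latTheta_half_add_one hb' hξ _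
  have h2 : C (Complex.I + 1) = thetaFactor N (Complex.I + 1) * A (-1 / (Complex.I + 1) + 1) :=
    hb.latTheta_half hξ (by simp)
  have h3 : A (Complex.I - 1) = thetaFactor N (Complex.I - 1) * A (-1 / (Complex.I - 1)) :=
    hb.latTheta_zero (by simp)
  have h4 : A (Complex.I + 1) = thetaFactor N Complex.I * C (-1 / Complex.I) :=
    hb.latTheta_add_one hξ (by simp)
  have h5 : A (Complex.I - 1 + 2) = A (Complex.I - 1) := latTheta_add_two hb' _
  have h6 : -1 / (Complex.I + 1) + 1 = -1 / (Complex.I - 1) := by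
    rw [add_comm Complex.I, sub_eq_neg_add]
    field_simp
    ring_nf
    simp [sub_eq_neg_add]
  have h7 : thetaFactor N Complex.I = 1 := by
    rw [thetaFactor, div_self Complex.I_ne_zero, Complex.one_cpow]
  rw [hI, h7, one_mul] at h4
  rw [show Complex.I - 1 + 2 = Complex.I + 1 by ring, h4] at h5
  rw [h6] at h2
  have hC : C Complex.I ≠ 0 := latTheta_I_ne_zero b _
  have h8 : Complex.exp (Real.pi * Complex.I * (‖ξ‖ ^ 2 / 4 : ℝ)) *
      thetaFactor N (Complex.I - 1) = thetaFactor N (Complex.I + 1) := by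
    have hA : A (-1 / (Complex.I - 1)) ≠ 0 := by
      intro h
      rw [h, mul_zero] at h3
      exact hC (h5.trans h3)
    refine mul_right_cancel₀ hA ?_
    rw [← h2, h1, mul_assoc, ← h3, h5]
  have h9 : Complex.exp (Real.pi * Complex.I * (N / 4 : ℝ)) *
      thetaFactor N (Complex.I - 1) = thetaFactor N (Complex.I + 1) := by
    set w := Complex.I / (Complex.I - 1) with hw
    have hw1 : w = (1 - Complex.I) / 2 := by
      rw [hw, sub_eq_neg_add, div_eq_div_iff hm two_ne_zero]
      ring_nf
      simp
    have hw0 : w ≠ 0 := div_ne_zero Complex.I_ne_zero (by rwa [sub_eq_neg_add])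
    have hw2 : Complex.I / (Complex.I + 1) = Complex.I * w := by
      rw [hw1, add_comm Complex.I, div_eq_iff hp]
      ring_nf
      simp
      ring
    have hre : 0 < w.re := by
      rw [hw1]
      norm_num
    have harg := abs_lt.mp (Complex.abs_arg_lt_pi_div_two_iff.mpr (Or.inl hre))
    have hlog : Complex.log (Complex.I * w) = Complex.log Complex.I + Complex.log w := by
      refine (Complex.log_mul_eq_add_log_iff Complex.I_ne_zero hw0).mpr ?_
      rw [Complex.arg_I]
      constructor <;> linarith [Real.pi_pos, harg.1, harg.2]
    rw [thetaFactor, thetaFactor, hw2, ← hw, Complex.cpow_def_of_ne_zero hw0,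
      Complex.cpow_def_of_ne_zero (mul_ne_zero Complex.I_ne_zero hw0), hlog, Complex.log_I,
      ← Complex.exp_add]
    congr 1
    push_cast
    ring
  have h10 := mul_right_cancel₀ (thetaFactor_ne_zero N (z := Complex.I - 1) (by simp))
    (h8.trans h9.symm)
  rw [Complex.exp_eq_exp_iff_exists_int] at h10
  obtain ⟨k, hk⟩ := h10
  refine ⟨k, ?_⟩
  have hpi : (Real.pi * Complex.I : ℂ) ≠ 0 := by simp
  have h11 : ((‖ξ‖ ^ 2 / 4 : ℝ) : ℂ) = ((N / 4 + 2 * k : ℝ) : ℂ) := by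
    refine mul_left_cancel₀ hpi (hk.trans ?_)
    push_cast
    ring
  have h12 := Complex.ofReal_injective h11
  linarith
end

open UpperHalfPlane ModularForm SlashInvariantForm Function.Periodic in
open scoped MatrixGroups in
theorem eq_zero_of_modular_of_exp_decay {N : ℕ} {f : ℂ → ℂ}
    (hf : DifferentiableOn ℂ f {z | 0 < z.im})
    (hT : ∀ z : ℂ, 0 < z.im → f (z + 1) = f z)
    (hS : ∀ z : ℂ, 0 < z.im → f (-1 / z) = z ^ (12 * N) * f z)
    {K : ℝ} (hK : 0 ≤ K)
    (hdecay : ∀ z : ℂ, 1 ≤ z.im → ‖f z‖ ≤ K * Real.exp (-(2 * Real.pi * (N + 1)) * z.im))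
    {z : ℂ} (hz : 0 < z.im) : f z = 0 := by
  let F : ℍ → ℂ := fun τ => f τ
  have hFT : F ∣[((12 * N : ℕ) : ℤ)] ModularGroup.T = F := by
    ext τ
    have hd : denom (ModularGroup.T : GL (Fin 2) ℝ) τ = 1 := by
      rw [ModularGroup.denom_apply]
      simp [ModularGroup.T]
    rw [SL_slash_apply, modular_T_smul, hd]
    simp [F, add_comm (1 : ℂ), hT _ τ.im_pos]
  have hFS : F ∣[((12 * N : ℕ) : ℤ)] ModularGroup.S = F := by
    ext τ
    have hτ : (τ : ℂ) ^ (12 * N) ≠ 0 := pow_ne_zero _ τ.ne_zero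
    have h := hS τ τ.im_pos
    rw [neg_div, one_div] at h
    have hd : denom (ModularGroup.S : GL (Fin 2) ℝ) τ = τ := by
      rw [ModularGroup.denom_apply]
      simp [ModularGroup.S]
    rw [SL_slash_apply, UpperHalfPlane.modular_S_smul, hd, zpow_neg, zpow_natCast]
    simp only [F, inv_neg, h]
    field_simp
  let G : ModularForm 𝒮ℒ ((12 * N : ℕ) : ℤ) :=
    { toFun := F
      slash_action_eq' := by
        rintro A ⟨A, rfl⟩
        exact slash_action_generators_SL2Z hFS hFT A
      holo' := by
        rw [UpperHalfPlane.mdifferentiable_iff]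
        refine hf.congr fun w hw => ?_
        simp [F, ofComplex_apply_of_im_pos hw]
      bdd_at_cusps' := fun {c} hc => by
        rw [Subgroup.IsArithmetic.isCusp_iff_isCusp_SL2Z] at hc
        rw [OnePoint.isBoundedAt_iff_forall_SL2Z hc]
        intro γ _
        rw [slash_action_generators_SL2Z hFS hFT, isBoundedAtImInfty_iff]
        refine ⟨K, 1, fun τ hτ => (hdecay τ hτ).trans (mul_le_of_le_one_right hK ?_)⟩
        rw [Real.exp_le_one_iff, neg_mul]
        have : (0 : ℝ) < (τ : ℂ).im := τ.im_pos
        have : 0 ≤ 2 * Real.pi * (N + 1) * (τ : ℂ).im := by positivity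
        linarith }
  have hcoeff (j : ℕ) (hj : j < N + 1) : (qExpansion 1 G).coeff j = 0 := by
    have hle (t : ℝ) (ht : 1 ≤ t) : ‖(qExpansion 1 G).coeff j‖ ≤ K * Real.exp (-t) := by
      have ht0 : 0 < t := by linarith
      rw [ModularFormClass.qExpansion_coeff_eq_intervalIntegral G one_pos (by simp) j ht0]
      rw [Complex.ofReal_one, div_one, one_mul]
      refine (intervalIntegral.norm_integral_le_of_norm_le_const (C := K * Real.exp (-t))
        fun u _ => ?_).trans (by simp)
      have h1 := hdecay (u + t * Complex.I) (by simpa using ht)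
      have him : ((u : ℂ) + t * Complex.I).im = t := by simp
      rw [norm_mul, norm_div, norm_one, norm_pow, norm_qParam, him, ← Real.exp_nat_mul,
        one_div, ← Real.exp_neg]
      rw [him] at h1
      refine (mul_le_mul_of_nonneg_left h1 (Real.exp_pos _).le).trans ?_
      rw [mul_left_comm, ← Real.exp_add]
      refine mul_le_mul_of_nonneg_left (Real.exp_le_exp.mpr ?_) hK
      have hj' : (j : ℝ) ≤ N := by exact_mod_cast Nat.lt_succ_iff.mp hj
      have hpi := Real.pi_gt_three
      have h2 : 0 ≤ Real.pi * t * (N - j) := by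
        have : 0 ≤ (N : ℝ) - j := by linarith
        positivity
      nlinarith
    have hlim : Filter.Tendsto (fun t : ℝ => K * Real.exp (-t)) Filter.atTop (nhds 0) := by
      simpa using (Real.tendsto_exp_neg_atTop_nhds_zero.const_mul K)
    have := ge_of_tendsto hlim (Filter.eventually_atTop.mpr ⟨1, hle⟩)
    exact norm_le_zero_iff.mp this
  have hG : G = 0 := by
    refine ModularForm.sturm_bound_levelOne_nat ?_
    rw [Nat.mul_div_cancel_left N (by norm_num)]
    refine lt_of_lt_of_le ?_ (PowerSeries.nat_le_order _ (N + 1) hcoeff)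
    exact_mod_cast Nat.lt_succ_self N
  exact congrArg (fun g : ModularForm 𝒮ℒ ((12 * N : ℕ) : ℤ) => g ⟨z, hz⟩) hG

section
open MeasureTheory
variable {ι : Type*} [Fintype ι] {E : Type*} [NormedAddCommGroup E] [InnerProductSpace ℝ E]
variable [FiniteDimensional ℝ E]

theorem differentiableOn_latTheta (b : Module.Basis ι ℝ E) (a : E) :
    DifferentiableOn ℂ (latTheta b a) {z | 0 < z.im} := by
  intro z hz
  have hz : 0 < z.im := hz
  have hopen : IsOpen {w : ℂ | z.im / 2 < w.im} := isOpen_lt continuous_const Complex.continuous_im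
  have hdiff : DifferentiableOn ℂ (latTheta b a) {w | z.im / 2 < w.im} := by
    refine Complex.differentiableOn_tsum_of_summable_norm
      (summable_exp_neg_norm_latPt_add_sq b (c := Real.pi * (z.im / 2)) (by positivity) a)
      (fun m => ?_) hopen fun m w hw => ?_
    · fun_prop
    · rw [norm_cexp_pi_I_mul, Real.exp_le_exp]
      have hw : z.im / 2 < w.im := hw
      have : Real.pi * (z.im / 2) ≤ Real.pi * w.im := by gcongr
      nlinarith [sq_nonneg ‖latPt b m + a‖]
  exact (hdiff.differentiableAt (hopen.mem_nhds (by simp; linarith))).differentiableWithinAt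

theorem exists_norm_latTheta_le (b : Module.Basis ι ℝ E) (a : E) {r : ℝ}
    (hr : ∀ m, r ≤ ‖latPt b m + a‖ ^ 2) :
    ∃ K : ℝ, 0 ≤ K ∧ ∀ z : ℂ, 1 ≤ z.im →
      ‖latTheta b a z‖ ≤ K * Real.exp (-(Real.pi * r) * z.im) := by
  have hs := summable_exp_neg_norm_latPt_add_sq b Real.pi_pos a
  refine ⟨(∑' m, Real.exp (-Real.pi * ‖latPt b m + a‖ ^ 2)) * Real.exp (Real.pi * r),
    mul_nonneg (tsum_nonneg fun _ => (Real.exp_pos _).le) (Real.exp_pos _).le, fun z hz => ?_⟩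
  rw [mul_assoc, ← Real.exp_add, ← tsum_mul_right]
  refine tsum_of_norm_bounded (hs.mul_right _).hasSum fun m => ?_
  rw [norm_cexp_pi_I_mul, ← Real.exp_add, Real.exp_le_exp]
  have : 0 ≤ Real.pi * ((z.im - 1) * (‖latPt b m + a‖ ^ 2 - r)) :=
    mul_nonneg Real.pi_pos.le (mul_nonneg (by linarith) (by linarith [hr m]))
  nlinarith

theorem IsSelfDualBasis.exists_norm_sq_le {b : Module.Basis ι ℝ E} (hb : IsSelfDualBasis b)
    (hb' : IsIntegralBasis b) {ξ : E} (hξ : IsCharVec b ξ)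
    (hξint : ∀ m, ∃ k : ℤ, ‖ξ + (2 : ℝ) • latPt b m‖ ^ 2 = (k : ℝ)) :
    ∃ m, ‖ξ + (2 : ℝ) • latPt b m‖ ^ 2 ≤ Module.finrank ℝ E := by
  by_contra! hcon
  set N := Module.finrank ℝ E
  set C := latTheta b ((1 / 2 : ℝ) • ξ)
  set A := latTheta b 0
  have hr (m : ι → ℤ) : ((N : ℝ) + 1) / 4 ≤ ‖latPt b m + (1 / 2 : ℝ) • ξ‖ ^ 2 := by
    obtain ⟨k, hk⟩ := hξint m
    have h1 := hcon m
    rw [hk] at h1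
    have h2 : (N : ℝ) + 1 ≤ k := by exact_mod_cast h1
    have h3 : latPt b m + (1 / 2 : ℝ) • ξ = (1 / 2 : ℝ) • (ξ + (2 : ℝ) • latPt b m) := by
      rw [smul_add, smul_smul, add_comm]
      norm_num
    rw [h3, norm_smul, mul_pow, hk]
    norm_num
    linarith
  obtain ⟨K, hK, hKC⟩ := exists_norm_latTheta_le b ((1 / 2 : ℝ) • ξ) hr
  obtain ⟨K', hK', hKA⟩ := exists_norm_latTheta_le b 0 (r := 0) (fun _ => sq_nonneg _)
  have hA1 (z : ℂ) : 0 < z.im → A (z + 1 + 1) = A z := fun _ => by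
    rw [add_assoc, one_add_one_eq_two]
    exact latTheta_add_two hb' z
  let f : ℂ → ℂ := fun z => (A z * A (z + 1) * C z) ^ 8
  have hf0 : f Complex.I = 0 := by
    refine eq_zero_of_modular_of_exp_decay (N := N) (f := f) (K := (K' * K' * K) ^ 8) ?_ ?_ ?_
      (by positivity) ?_ (by simp)
    · have h1 := differentiableOn_latTheta b 0
      have h2 := differentiableOn_latTheta b ((1 / 2 : ℝ) • ξ)
      refine ((h1.mul (h1.comp (differentiableOn_id.add_const 1) fun z hz => ?_)).mul h2).pow 8
      simpa using hz
    · intro z hz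
      obtain ⟨k, hk⟩ := hξint 0
      rw [latPt_zero, smul_zero, add_zero] at hk
      simp only [f, hA1 z hz]
      rw [show C (z + 1) = _ from latTheta_half_add_one hb' hξ z, mul_left_comm,
        mul_comm (A (z + 1)), mul_pow, ← Complex.exp_nat_mul, hk]
      have : Complex.exp ((8 : ℕ) * (Real.pi * Complex.I * ((k / 4 : ℝ) : ℂ))) = 1 := by
        rw [Complex.exp_eq_one_iff]
        exact ⟨k, by push_cast; ring⟩
      rw [this, one_mul]
    · intro z hz
      have hz0 : z ≠ 0 := by rintro rfl; simp at hz
      have h1 : A z = thetaFactor N z * A (-1 / z) := hb.latTheta_zero hz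
      have h2 : C z = thetaFactor N z * A (-1 / z + 1) := hb.latTheta_half hξ hz
      have h3 : A (z + 1) = thetaFactor N z * C (-1 / z) := hb.latTheta_add_one hξ hz
      have h4 : f z = thetaFactor N z ^ 24 * f (-1 / z) := by
        simp only [f, h1, h2, h3]
        ring
      rw [h4, thetaFactor_pow N hz0, mul_inv_cancel_left₀ (pow_ne_zero _ hz0)]
    · intro z hz
      have h1 : ‖A z‖ ≤ K' := by simpa using hKA z hz
      have h2 : ‖A (z + 1)‖ ≤ K' := by simpa using hKA (z + 1) (by simpa using hz)
      have h3 := hKC z hz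
      simp only [f, norm_pow, norm_mul]
      calc (‖A z‖ * ‖A (z + 1)‖ * ‖C z‖) ^ 8
          ≤ (K' * K' * (K * Real.exp (-(Real.pi * ((N + 1) / 4)) * z.im))) ^ 8 := by gcongr
        _ = _ := by
          rw [← mul_assoc, mul_pow, ← Real.exp_nat_mul]
          congr 2
          push_cast
          ring
  have hC : C Complex.I ≠ 0 := latTheta_I_ne_zero b _
  have hA : A Complex.I ≠ 0 := latTheta_I_ne_zero b 0
  have hB : A (Complex.I + 1) ≠ 0 := by
    have h3 : A (Complex.I + 1) = thetaFactor N Complex.I * C (-1 / Complex.I) :=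
      hb.latTheta_add_one hξ (by simp)
    have hI : (-1 / Complex.I) = Complex.I := by
      rw [div_eq_iff Complex.I_ne_zero, Complex.I_mul_I]
    rw [h3, hI]
    exact mul_ne_zero (thetaFactor_ne_zero N (by simp)) hC
  exact pow_ne_zero 8 (mul_ne_zero (mul_ne_zero hA hB) hC) hf0
end

section
variable {E : Type*} [NormedAddCommGroup E] [InnerProductSpace ℝ E]

/-- A subgroup which equals its own dual. -/
def IsSelfDual (U : Submodule ℤ E) : Prop :=
  ∀ x, x ∈ U ↔ ∀ v ∈ U, ∃ k : ℤ, ⟪x, v⟫ = (k : ℝ)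

/-- Elements pairing with every vector of `U` as the norm does modulo `2`. -/
def IsCharOn (U : Submodule ℤ E) (ξ : E) : Prop :=
  ∀ v ∈ U, ∃ k : ℤ, ⟪v, ξ⟫ - ⟪v, v⟫ = 2 * (k : ℝ)

theorem IsSelfDual.inner_mem {U : Submodule ℤ E} (hU : IsSelfDual U) {v w : E} (hv : v ∈ U)
    (hw : w ∈ U) : ∃ k : ℤ, ⟪v, w⟫ = (k : ℝ) := (hU v).1 hv w hw

theorem IsSelfDual.span_eq_top [FiniteDimensional ℝ E] {U : Submodule ℤ E} (hU : IsSelfDual U) :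
    Submodule.span ℝ (U : Set E) = ⊤ := by
  rw [← Submodule.orthogonal_eq_bot_iff, Submodule.eq_bot_iff]
  intro x hx
  by_contra hx0
  have hxn : 0 < ‖x‖ := norm_pos_iff.2 hx0
  have horth (v : E) (hv : v ∈ U) : ⟪x, v⟫ = 0 := by
    rw [real_inner_comm]
    exact (Submodule.mem_orthogonal _ _).1 hx v (Submodule.subset_span hv)
  have hmem : (√(1 / 2) / ‖x‖) • x ∈ U := (hU _).2 fun v hv =>
    ⟨0, by rw [real_inner_smul_left, horth v hv]; simp⟩
  obtain ⟨k, hk⟩ := hU.inner_mem hmem hmem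
  rw [real_inner_self_eq_norm_sq, norm_smul, mul_pow, Real.norm_eq_abs, sq_abs, div_pow,
    Real.sq_sqrt (by norm_num), div_mul_cancel₀ _ (by positivity)] at hk
  have h2 : (1 : ℝ) = ((2 * k : ℤ) : ℝ) := by push_cast; linarith
  have h3 : (1 : ℤ) = 2 * k := by exact_mod_cast h2
  omega

theorem IsSelfDual.discreteTopology {U : Submodule ℤ E} (hU : IsSelfDual U) :
    DiscreteTopology U := by
  refine DiscreteTopology.of_forall_le_norm zero_lt_one fun x hx => ?_
  obtain ⟨k, hk⟩ := hU.inner_mem x.2 x.2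
  rw [real_inner_self_eq_norm_sq] at hk
  have hpos : 0 < ‖(x : E)‖ := norm_pos_iff.2 (by simpa using hx)
  have h1 : (0 : ℝ) < k := hk ▸ (by positivity)
  have h2 : (1 : ℝ) ≤ k := by exact_mod_cast h1
  change 1 ≤ ‖(x : E)‖
  nlinarith

theorem IsSelfDual.exists_basis [FiniteDimensional ℝ E] {U : Submodule ℤ E} (hU : IsSelfDual U) :
    ∃ b : Module.Basis (Fin (Module.finrank ℝ E)) ℝ E,
      Submodule.span ℤ (Set.range b) = U := by
  have := hU.discreteTopology
  have : IsZLattice ℝ U := ⟨hU.span_eq_top⟩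
  have := ZLattice.module_free ℝ U
  have := ZLattice.module_finite ℝ U
  let b := (Module.Free.chooseBasis ℤ U).ofZLatticeBasis ℝ
  have hb : Submodule.span ℤ (Set.range b) = U := (Module.Free.chooseBasis ℤ U).ofZLatticeBasis_span ℝ
  refine ⟨b.reindex (Fintype.equivFinOfCardEq (Module.finrank_eq_card_basis b).symm), ?_⟩
  rwa [Module.Basis.range_reindex]

theorem mem_span_range_iff_exists_latPt {ι : Type*} [Fintype ι] (b : Module.Basis ι ℝ E) (x : E) :
    x ∈ Submodule.span ℤ (Set.range b) ↔ ∃ m, latPt b m = x := by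
  constructor
  · intro hx
    rw [Submodule.mem_span_range_iff_exists_fun] at hx
    obtain ⟨c, rfl⟩ := hx
    refine ⟨c, ?_⟩
    rw [latPt_eq_sum]
    exact Finset.sum_congr rfl fun i _ => Int.cast_smul_eq_zsmul ℝ _ _
  · rintro ⟨m, rfl⟩
    exact latPt_mem_span b m

theorem IsCharOn.add_two_smul {U : Submodule ℤ E} (hU : IsSelfDual U) {ξ v : E}
    (hξ : IsCharOn U ξ) (hv : v ∈ U) : IsCharOn U (ξ + (2 : ℝ) • v) := by
  intro u hu
  obtain ⟨k, hk⟩ := hξ u hu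
  obtain ⟨l, hl⟩ := hU.inner_mem hu hv
  refine ⟨k + l, ?_⟩
  rw [inner_add_right, real_inner_smul_right, hl]
  push_cast
  linarith

theorem IsSelfDual.isSelfDualBasis {ι : Type*} [Fintype ι] {b : Module.Basis ι ℝ E}
    (hU : IsSelfDual (Submodule.span ℤ (Set.range b))) : IsSelfDualBasis b := by
  intro x
  rw [← mem_span_range_iff_exists_latPt, hU x]
  constructor
  · exact fun h i => h _ (Submodule.subset_span ⟨i, rfl⟩)
  · intro h v hv
    induction hv using Submodule.span_induction with
    | mem v hv => obtain ⟨i, rfl⟩ := hv; exact h i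
    | zero => exact ⟨0, by simp⟩
    | add v w _ _ hv hw =>
      obtain ⟨k, hk⟩ := hv
      obtain ⟨l, hl⟩ := hw
      exact ⟨k + l, by rw [inner_add_right, hk, hl]; push_cast; rfl⟩
    | smul c v _ hv =>
      obtain ⟨k, hk⟩ := hv
      refine ⟨c * k, ?_⟩
      rw [← Int.cast_smul_eq_zsmul ℝ, real_inner_smul_right, hk]
      push_cast
      rfl

theorem IsSelfDual.isIntegralBasis {ι : Type*} [Fintype ι] {b : Module.Basis ι ℝ E}
    (hU : IsSelfDual (Submodule.span ℤ (Set.range b))) : IsIntegralBasis b := by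
  intro m
  rw [← real_inner_self_eq_norm_sq]
  exact hU.inner_mem (latPt_mem_span b m) (latPt_mem_span b m)

theorem IsCharOn.isCharVec {ι : Type*} [Fintype ι] {b : Module.Basis ι ℝ E} {ξ : E}
    (hξ : IsCharOn (Submodule.span ℤ (Set.range b)) ξ) : IsCharVec b ξ := by
  intro m
  rw [← real_inner_self_eq_norm_sq]
  exact hξ _ (latPt_mem_span b m)

theorem isCharOn_span {S : Set E}
    (hU : IsSelfDual (Submodule.span ℤ S)) {ξ : E}
    (hξ : ∀ v ∈ S, ∃ k : ℤ, ⟪v, ξ⟫ - ⟪v, v⟫ = 2 * (k : ℝ)) :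
    IsCharOn (Submodule.span ℤ S) ξ := by
  intro v hv
  induction hv using Submodule.span_induction with
  | mem v hv => exact hξ v hv
  | zero => exact ⟨0, by simp⟩
  | add v w hv' hw' hv hw =>
    obtain ⟨k, hk⟩ := hv
    obtain ⟨l, hl⟩ := hw
    obtain ⟨j, hj⟩ := hU.inner_mem hv' hw'
    refine ⟨k + l - j, ?_⟩
    rw [inner_add_left, real_inner_add_add_self, hj]
    push_cast
    linarith
  | smul c v hv' hv =>
    obtain ⟨k, hk⟩ := hv
    obtain ⟨j, hj⟩ := hU.inner_mem hv' hv'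
    obtain ⟨i, hi⟩ := (Int.even_mul_succ_self (c - 1))
    have hi' : ((c : ℝ) - 1) * (c - 1 + 1) = i + i := by exact_mod_cast hi
    refine ⟨c * k - i * j, ?_⟩
    rw [← Int.cast_smul_eq_zsmul ℝ, real_inner_smul_left, real_inner_smul_left,
      real_inner_smul_right]
    push_cast
    rw [hj] at hk ⊢
    linear_combination (c : ℝ) * hk - (j : ℝ) * hi'

variable [FiniteDimensional ℝ E]

theorem IsSelfDual.exists_isCharOn {U : Submodule ℤ E} (hU : IsSelfDual U) :
    ∃ ξ ∈ U, IsCharOn U ξ := by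
  obtain ⟨b, rfl⟩ := hU.exists_basis
  obtain ⟨ξ, hξ⟩ := exists_inner_basis_eq b fun i => ⟪b i, b i⟫
  refine ⟨ξ, ?_, isCharOn_span hU ?_⟩
  · rw [mem_span_range_iff_exists_latPt, hU.isSelfDualBasis ξ]
    intro i
    rw [hξ]
    exact hU.inner_mem (Submodule.subset_span ⟨i, rfl⟩) (Submodule.subset_span ⟨i, rfl⟩)
  · rintro _ ⟨i, rfl⟩
    exact ⟨0, by rw [real_inner_comm, hξ]; simp⟩

theorem IsSelfDual.exists_inner_self_eq {U : Submodule ℤ E} (hU : IsSelfDual U) {ξ : E}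
    (hξ : IsCharOn U ξ) : ∃ k : ℤ, ⟪ξ, ξ⟫ = Module.finrank ℝ E + 8 * (k : ℝ) := by
  obtain ⟨b, rfl⟩ := hU.exists_basis
  rw [real_inner_self_eq_norm_sq]
  exact hU.isSelfDualBasis.exists_norm_sq_eq hU.isIntegralBasis hξ.isCharVec

/-- Every self-dual lattice has a characteristic vector of norm at most the rank. -/
theorem IsSelfDual.exists_inner_self_le {U : Submodule ℤ E} (hU : IsSelfDual U) :
    ∃ ξ ∈ U, IsCharOn U ξ ∧ ⟪ξ, ξ⟫ ≤ (Module.finrank ℝ E : ℝ) := by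
  obtain ⟨ξ, hξU, hξ⟩ := hU.exists_isCharOn
  obtain ⟨b, rfl⟩ := hU.exists_basis
  have hmem (m) : ξ + (2 : ℝ) • latPt b m ∈ Submodule.span ℤ (Set.range b) := by
    refine add_mem hξU ?_
    rw [two_smul]
    exact add_mem (latPt_mem_span b m) (latPt_mem_span b m)
  obtain ⟨m, hm⟩ := hU.isSelfDualBasis.exists_norm_sq_le hU.isIntegralBasis hξ.isCharVec fun m => by
    rw [← real_inner_self_eq_norm_sq]
    exact hU.inner_mem (hmem m) (hmem m)
  refine ⟨_, hmem m, hξ.add_two_smul hU (latPt_mem_span b m), ?_⟩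
  rwa [real_inner_self_eq_norm_sq]

end

section
variable {E F : Type*} [NormedAddCommGroup E] [InnerProductSpace ℝ E]
  [NormedAddCommGroup F] [InnerProductSpace ℝ F]

/-- `L` is an integral subgroup whose dual is `L ∪ (w + L)`, where `w` has half-odd norm. -/
structure IsHalfDual (L : Submodule ℤ E) (w : E) : Prop where
  inner_mem : ∀ u ∈ L, ∀ v ∈ L, ∃ k : ℤ, ⟪u, v⟫ = (k : ℝ)
  inner_right : ∀ v ∈ L, ∃ k : ℤ, ⟪w, v⟫ = (k : ℝ)
  mem_or : ∀ x, (∀ v ∈ L, ∃ k : ℤ, ⟪x, v⟫ = (k : ℝ)) → x ∈ L ∨ x - w ∈ L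
  inner_self : ∃ k : ℤ, ⟪w, w⟫ = (k : ℝ) + 1 / 2

theorem withLp_prod_inner (x y : WithLp 2 (E × F)) :
    ⟪x, y⟫ = ⟪x.fst, y.fst⟫ + ⟪x.snd, y.snd⟫ := WithLp.prod_inner_apply x y

theorem int_ne_int_add_half (k l : ℤ) : (k : ℝ) ≠ (l : ℝ) + 1 / 2 := by
  intro h
  have h1 : ((2 * k : ℤ) : ℝ) = ((2 * l + 1 : ℤ) : ℝ) := by push_cast; linarith
  have h2 : 2 * k = 2 * l + 1 := by exact_mod_cast h1
  omega

namespace IsHalfDual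
variable {L : Submodule ℤ E} {M : Submodule ℤ F} {w : E} {z : F}

theorem notMem (h : IsHalfDual L w) : w ∉ L := fun hw => by
  obtain ⟨k, hk⟩ := h.inner_right w hw
  obtain ⟨l, hl⟩ := h.inner_self
  exact int_ne_int_add_half k l (hk.symm.trans hl)

theorem add_self_mem (h : IsHalfDual L w) : w + w ∈ L := by
  rcases h.mem_or (w + w) fun v hv => by
    obtain ⟨k, hk⟩ := h.inner_right v hv
    exact ⟨k + k, by rw [inner_add_left, hk]; push_cast; rfl⟩ with h1 | h1
  · exact h1
  · exact absurd (by simpa using h1) h.notMem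

theorem add_mem_of_sub_mem (h : IsHalfDual L w) {x y : E} (hx : x - w ∈ L) (hy : y - w ∈ L) :
    x + y ∈ L := by
  convert L.add_mem (L.add_mem hx hy) h.add_self_mem using 1
  abel

theorem neg_sub_mem (h : IsHalfDual L w) {x : E} (hx : x - w ∈ L) : -x - w ∈ L := by
  convert L.neg_mem (L.add_mem hx h.add_self_mem) using 1
  abel

theorem inner_dual (h : IsHalfDual L w) {x : E} (hx : x ∈ L ∨ x - w ∈ L) {v : E} (hv : v ∈ L) :
    ∃ k : ℤ, ⟪x, v⟫ = (k : ℝ) := by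
  rcases hx with hx | hx
  · exact h.inner_mem x hx v hv
  · obtain ⟨k, hk⟩ := h.inner_mem _ hx v hv
    obtain ⟨l, hl⟩ := h.inner_right v hv
    refine ⟨k + l, ?_⟩
    rw [inner_sub_left] at hk
    push_cast
    linarith

/-- Two vectors in the nontrivial coset have half-odd inner product. -/
theorem inner_coset (h : IsHalfDual L w) {x y : E} (hx : x - w ∈ L) (hy : y - w ∈ L) :
    ∃ k : ℤ, ⟪x, y⟫ = (k : ℝ) + 1 / 2 := by
  obtain ⟨k, hk⟩ := h.inner_dual (.inr hx) hy
  obtain ⟨l, hl⟩ := h.inner_right _ hx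
  obtain ⟨j, hj⟩ := h.inner_self
  refine ⟨k + l + j, ?_⟩
  rw [inner_sub_right] at hk hl
  rw [real_inner_comm] at hl
  push_cast
  linarith

/-- The overlattice of `L ⊕ M` glued along the nontrivial cosets of `L` and `M`. -/
def glue (hL : IsHalfDual L w) (hM : IsHalfDual M z) : Submodule ℤ (WithLp 2 (E × F)) :=
  AddSubgroup.toIntSubmodule
  { carrier := {p | (p.fst ∈ L ∧ p.snd ∈ M) ∨ (p.fst - w ∈ L ∧ p.snd - z ∈ M)}
    zero_mem' := .inl ⟨L.zero_mem, M.zero_mem⟩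
    add_mem' := by
      rintro p q (⟨h1, h2⟩ | ⟨h1, h2⟩) (⟨h3, h4⟩ | ⟨h3, h4⟩)
      · exact .inl ⟨add_mem h1 h3, add_mem h2 h4⟩
      · exact .inr ⟨by simpa [add_sub_assoc] using add_mem h1 h3,
          by simpa [add_sub_assoc] using add_mem h2 h4⟩
      · exact .inr ⟨by simpa [add_sub_right_comm] using add_mem h1 h3,
          by simpa [add_sub_right_comm] using add_mem h2 h4⟩
      · exact .inl ⟨hL.add_mem_of_sub_mem h1 h3, hM.add_mem_of_sub_mem h2 h4⟩
    neg_mem' := by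
      rintro p (⟨h1, h2⟩ | ⟨h1, h2⟩)
      · exact .inl ⟨neg_mem h1, neg_mem h2⟩
      · exact .inr ⟨hL.neg_sub_mem h1, hM.neg_sub_mem h2⟩ }

theorem isSelfDual_glue (hL : IsHalfDual L w) (hM : IsHalfDual M z) :
    IsSelfDual (hL.glue hM) := by
  intro x
  constructor
  · rintro hx v hv
    rw [withLp_prod_inner]
    rcases hv with ⟨h3, h4⟩ | ⟨h3, h4⟩
    · obtain ⟨k, hk⟩ := hL.inner_dual (hx.imp And.left And.left) h3
      obtain ⟨l, hl⟩ := hM.inner_dual (hx.imp And.right And.right) h4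
      exact ⟨k + l, by rw [hk, hl]; push_cast; rfl⟩
    · rcases hx with ⟨h1, h2⟩ | ⟨h1, h2⟩
      · obtain ⟨k, hk⟩ := hL.inner_dual (.inr h3) h1
        obtain ⟨l, hl⟩ := hM.inner_dual (.inr h4) h2
        rw [real_inner_comm] at hk hl
        exact ⟨k + l, by rw [hk, hl]; push_cast; rfl⟩
      · obtain ⟨k, hk⟩ := hL.inner_coset h1 h3
        obtain ⟨l, hl⟩ := hM.inner_coset h2 h4
        exact ⟨k + l + 1, by rw [hk, hl]; push_cast; ring⟩
  · intro hx
    have hfst := hL.mem_or x.fst fun v hv => by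
      simpa [withLp_prod_inner] using hx (WithLp.toLp 2 (v, 0)) (.inl ⟨hv, M.zero_mem⟩)
    have hsnd := hM.mem_or x.snd fun v hv => by
      simpa [withLp_prod_inner] using hx (WithLp.toLp 2 (0, v)) (.inl ⟨L.zero_mem, hv⟩)
    obtain ⟨j, hj⟩ := hx (WithLp.toLp 2 (w, z)) (.inr (by simp))
    rw [withLp_prod_inner] at hj
    change ⟪x.fst, w⟫ + ⟪x.snd, z⟫ = (j : ℝ) at hj
    rcases hfst with h1 | h1 <;> rcases hsnd with h2 | h2
    · exact .inl ⟨h1, h2⟩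
    · obtain ⟨k, hk⟩ := hL.inner_right _ h1
      obtain ⟨l, hl⟩ := hM.inner_coset h2 (y := z) (by simp)
      rw [real_inner_comm] at hk
      refine absurd ?_ (int_ne_int_add_half (j - k) l)
      push_cast
      rw [← hl, ← hk, ← hj]
      ring
    · obtain ⟨k, hk⟩ := hM.inner_right _ h2
      obtain ⟨l, hl⟩ := hL.inner_coset h1 (y := w) (by simp)
      rw [real_inner_comm] at hk
      refine absurd ?_ (int_ne_int_add_half (j - k) l)
      push_cast
      rw [← hl, ← hk, ← hj]
      ring
    · exact .inr ⟨h1, h2⟩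

theorem mem_dual_of_mem_glue (hL : IsHalfDual L w) (hM : IsHalfDual M z)
    {p : WithLp 2 (E × F)} (hp : p ∈ hL.glue hM) :
    (p.fst ∈ L ∨ p.fst - w ∈ L) ∧ (p.snd ∈ M ∨ p.snd - z ∈ M) :=
  ⟨hp.imp And.left And.left, hp.imp And.right And.right⟩

theorem isCharOn_fst (hL : IsHalfDual L w) (hM : IsHalfDual M z) {p : WithLp 2 (E × F)}
    (hp : IsCharOn (hL.glue hM) p) : IsCharOn L p.fst := fun v hv => by
  simpa [withLp_prod_inner] using hp (WithLp.toLp 2 (v, 0)) (.inl ⟨hv, M.zero_mem⟩)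

theorem isCharOn_snd (hL : IsHalfDual L w) (hM : IsHalfDual M z) {p : WithLp 2 (E × F)}
    (hp : IsCharOn (hL.glue hM) p) : IsCharOn M p.snd := fun v hv => by
  simpa [withLp_prod_inner] using hp (WithLp.toLp 2 (0, v)) (.inl ⟨L.zero_mem, hv⟩)

/-- A characteristic covector of `L` lies in the lattice itself. -/
theorem mem_of_isCharOn (h : IsHalfDual L w) {ξ : E} (hξ : ξ ∈ L ∨ ξ - w ∈ L)
    (hc : IsCharOn L ξ) : ξ ∈ L := by
  refine hξ.resolve_right fun hw => ?_
  obtain ⟨k, hk⟩ := hc _ h.add_self_mem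
  obtain ⟨l, hl⟩ := h.inner_coset (x := w) (by simp) hw
  obtain ⟨j, hj⟩ := h.inner_self
  rw [real_inner_add_add_self, inner_add_left, hl, hj] at hk
  have h1 : ((2 * l + 1 - 4 * j - 2 : ℤ) : ℝ) = ((2 * k : ℤ) : ℝ) := by
    push_cast
    linarith
  have h2 : 2 * l + 1 - 4 * j - 2 = 2 * k := by exact_mod_cast h1
  omega

/-- Extension of a characteristic pair from `L ⊕ M` to the glued lattice. -/
theorem isCharOn_glue (hL : IsHalfDual L w) (hM : IsHalfDual M z) {ξ : E} {η : F}
    (hξ : IsCharOn L ξ) (hη : IsCharOn M η)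
    (hwz : ∃ k : ℤ, ⟪w, ξ⟫ + ⟪z, η⟫ - (⟪w, w⟫ + ⟪z, z⟫) = 2 * (k : ℝ)) :
    IsCharOn (hL.glue hM) (WithLp.toLp 2 (ξ, η)) := by
  intro v hv
  rw [withLp_prod_inner, withLp_prod_inner]
  change ∃ k : ℤ, ⟪v.fst, ξ⟫ + ⟪v.snd, η⟫ - _ = _
  rcases hv with ⟨h1, h2⟩ | ⟨h1, h2⟩
  · obtain ⟨k, hk⟩ := hξ _ h1
    obtain ⟨l, hl⟩ := hη _ h2
    exact ⟨k + l, by push_cast; linarith⟩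
  · obtain ⟨k, hk⟩ := hξ _ h1
    obtain ⟨l, hl⟩ := hη _ h2
    obtain ⟨i, hi⟩ := hwz
    obtain ⟨j, hj⟩ := hL.inner_right _ h1
    obtain ⟨m, hm⟩ := hM.inner_right _ h2
    refine ⟨k + l + i - j - m, ?_⟩
    rw [real_inner_sub_sub_self, inner_sub_left] at hk hl
    rw [inner_sub_right, real_inner_comm] at hj hm
    push_cast
    linarith

end IsHalfDual

/-- The root lattice `A₁`, generated by `√2` in `ℝ`, has dual `A₁ ∪ (√2 / 2 + A₁)`. -/
theorem isHalfDual_span_sqrt_two : IsHalfDual (Submodule.span ℤ {√2}) (√2 / 2) := by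
  have h2 : √2 * √2 = 2 := Real.mul_self_sqrt (by norm_num)
  have h0 : √2 ≠ 0 := by positivity
  refine ⟨?_, ?_, ?_, ⟨0, ?_⟩⟩
  · intro u hu v hv
    obtain ⟨a, rfl⟩ := Submodule.mem_span_singleton.1 hu
    obtain ⟨c, rfl⟩ := Submodule.mem_span_singleton.1 hv
    refine ⟨2 * a * c, ?_⟩
    simp only [zsmul_eq_mul, Real.inner_apply]
    push_cast
    linear_combination (a * c : ℝ) * h2
  · intro v hv
    obtain ⟨c, rfl⟩ := Submodule.mem_span_singleton.1 hv
    refine ⟨c, ?_⟩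
    simp only [zsmul_eq_mul, Real.inner_apply]
    linear_combination (c / 2 : ℝ) * h2
  · intro x hx
    obtain ⟨k, hk⟩ := hx _ (Submodule.mem_span_singleton_self _)
    rw [Real.inner_apply] at hk
    have hx' : x = k * (√2 / 2) := by
      linear_combination (√2 / 2) * hk - (x / 2) * h2
    simp only [Submodule.mem_span_singleton, zsmul_eq_mul]
    rcases Int.even_or_odd' k with ⟨c, rfl | rfl⟩
    · exact .inl ⟨c, by rw [hx']; push_cast; ring⟩
    · exact .inr ⟨c, by rw [hx']; push_cast; ring⟩
  · rw [Real.inner_apply]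
    push_cast
    linear_combination (1 / 4 : ℝ) * h2

theorem isCharOn_span_sqrt_two (j : ℤ) : IsCharOn (Submodule.span ℤ {√2}) (j * √2) := by
  have h2 : √2 * √2 = 2 := Real.mul_self_sqrt (by norm_num)
  intro v hv
  obtain ⟨c, rfl⟩ := Submodule.mem_span_singleton.1 hv
  refine ⟨c * j - c * c, ?_⟩
  simp only [zsmul_eq_mul, Real.inner_apply]
  push_cast
  linear_combination (c * j - c * c : ℝ) * h2

variable [FiniteDimensional ℝ E]

/-- The norm of a characteristic covector is `n ± 1` modulo `8`. -/
theorem IsHalfDual.exists_inner_self_eq {L : Submodule ℤ E} {w : E} (h : IsHalfDual L w) {ξ : E}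
    (hξ : ξ ∈ L ∨ ξ - w ∈ L) (hc : IsCharOn L ξ) :
    ∃ ε k : ℤ, (ε = 1 ∨ ε = -1) ∧ ⟪ξ, ξ⟫ = (Module.finrank ℝ E : ℝ) + ε + 8 * (k : ℝ) := by
  have h2 : √2 * √2 = 2 := Real.mul_self_sqrt (by norm_num)
  obtain ⟨k, hk⟩ := h.inner_right ξ (h.mem_of_isCharOn hξ hc)
  obtain ⟨l, hl⟩ := h.inner_self
  obtain ⟨j, m, hj, hm⟩ : ∃ j m : ℤ, (j = 0 ∨ j = 1) ∧ k + j - (l + 1) = 2 * m := by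
    rcases Int.even_or_odd' (k - (l + 1)) with ⟨c, hc | hc⟩
    · exact ⟨0, c, .inl rfl, by omega⟩
    · exact ⟨1, c + 1, .inr rfl, by omega⟩
  have hm' : (k : ℝ) + j - (l + 1) = 2 * m := by exact_mod_cast hm
  have hchar := h.isCharOn_glue isHalfDual_span_sqrt_two hc (isCharOn_span_sqrt_two j) ⟨m, by
    rw [hk, hl, Real.inner_apply, Real.inner_apply]
    linear_combination hm' + (j / 2 - 1 / 4 : ℝ) * h2⟩
  obtain ⟨i, hi⟩ := (h.isSelfDual_glue isHalfDual_span_sqrt_two).exists_inner_self_eq hchar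
  have hdim : Module.finrank ℝ (WithLp 2 (E × ℝ)) = Module.finrank ℝ E + 1 := by
    rw [(WithLp.linearEquiv 2 ℝ (E × ℝ)).finrank_eq, Module.finrank_prod, Module.finrank_self]
  rw [hdim, withLp_prod_inner] at hi
  change ⟪ξ, ξ⟫ + ⟪(j * √2 : ℝ), (j * √2 : ℝ)⟫ = _ at hi
  rw [Real.inner_apply] at hi
  push_cast at hi
  rcases hj with rfl | rfl
  · refine ⟨1, i, .inl rfl, ?_⟩
    push_cast at hi ⊢
    linarith
  · refine ⟨-1, i, .inr rfl, ?_⟩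
    push_cast at hi ⊢
    linarith

/-- A half-dual lattice has two characteristic covectors whose norms are congruent to `n + 1` and
`n - 1` modulo `8` and add up to at most `2 * n`. -/
theorem IsHalfDual.exists_inner_self_add_le {L : Submodule ℤ E} {w : E} (h : IsHalfDual L w) :
    ∃ ξ ∈ L, ∃ η ∈ L, IsCharOn L ξ ∧ IsCharOn L η ∧
      (∃ k : ℤ, ⟪ξ, ξ⟫ = (Module.finrank ℝ E : ℝ) + 1 + 8 * (k : ℝ)) ∧
      (∃ k : ℤ, ⟪η, η⟫ = (Module.finrank ℝ E : ℝ) - 1 + 8 * (k : ℝ)) ∧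
      ⟪ξ, ξ⟫ + ⟪η, η⟫ ≤ 2 * Module.finrank ℝ E := by
  have hU := h.isSelfDual_glue h
  obtain ⟨p, hp, hpc, hle⟩ := hU.exists_inner_self_le
  obtain ⟨i, hi⟩ := hU.exists_inner_self_eq hpc
  have hdim : Module.finrank ℝ (WithLp 2 (E × E)) = Module.finrank ℝ E + Module.finrank ℝ E := by
    rw [(WithLp.linearEquiv 2 ℝ (E × E)).finrank_eq, Module.finrank_prod]
  rw [hdim, withLp_prod_inner] at hi hle
  push_cast at hi hle
  obtain ⟨h1, h2⟩ := h.mem_dual_of_mem_glue h hp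
  have hc1 := h.isCharOn_fst h hpc
  have hc2 := h.isCharOn_snd h hpc
  have m1 := h.mem_of_isCharOn h1 hc1
  have m2 := h.mem_of_isCharOn h2 hc2
  obtain ⟨ε, k, hε, hk⟩ := h.exists_inner_self_eq h1 hc1
  obtain ⟨δ, l, hδ, hl⟩ := h.exists_inner_self_eq h2 hc2
  have hsum : ε + δ + 8 * (k + l) = 8 * i := by
    have : ((ε + δ + 8 * (k + l) : ℤ) : ℝ) = ((8 * i : ℤ) : ℝ) := by
      push_cast
      linarith
    exact_mod_cast this
  rcases hε with rfl | rfl <;> rcases hδ with rfl | rfl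
  · omega
  · exact ⟨_, m1, _, m2, hc1, hc2, ⟨k, by rw [hk]; simp⟩, ⟨l, by rw [hl]; push_cast; ring⟩,
      by linarith⟩
  · exact ⟨_, m2, _, m1, hc2, hc1, ⟨l, by rw [hl]; simp⟩, ⟨k, by rw [hk]; push_cast; ring⟩,
      by linarith⟩
  · omega

end

/-- The subgroup underlying a lattice. -/
def IsLattice.toSubmodule {n : ℕ} {Λ : Set (EuclideanSpace ℝ (Fin n))} (h : IsLattice Λ) :
    Submodule ℤ (EuclideanSpace ℝ (Fin n)) :=
  AddSubgroup.toIntSubmodule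
    { carrier := Λ
      zero_mem' := h.1.1
      add_mem' := fun hx hy => h.1.2.1 _ hx _ hy
      neg_mem' := fun hx => h.1.2.2 _ hx }

theorem IsLattice.mem_toSubmodule {n : ℕ} {Λ : Set (EuclideanSpace ℝ (Fin n))} (h : IsLattice Λ)
    {x : EuclideanSpace ℝ (Fin n)} : x ∈ h.toSubmodule ↔ x ∈ Λ := Iff.rfl

theorem IsLattice.mem_of_dual_dual {n : ℕ} {Λ : Set (EuclideanSpace ℝ (Fin n))}
    (h : IsLattice Λ) {x : EuclideanSpace ℝ (Fin n)}
    (hx : ∀ y ∈ dualSet Λ, ∃ k : ℤ, ⟪x, y⟫ = (k : ℝ)) : x ∈ Λ := by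
  obtain ⟨b, hbΛ, -, hgen⟩ := h.2.1
  have hspan : ⊤ ≤ Submodule.span ℝ (Set.range b) := by
    rw [← h.2.2.1, Submodule.span_le]
    intro v hv
    obtain ⟨c, rfl⟩ := hgen v hv
    exact sum_mem fun i _ => Submodule.smul_mem _ _ (Submodule.subset_span ⟨i, rfl⟩)
  let B : Module.Basis (Fin n) ℝ (EuclideanSpace ℝ (Fin n)) :=
    basisOfTopLeSpanOfCardEqFinrank b hspan (by simp)
  have hB (i : Fin n) : B i = b i := by simp [B]
  have hcoord (i : Fin n) : ∃ k : ℤ, B.repr x i = (k : ℝ) := by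
    obtain ⟨y, hy⟩ := exists_inner_basis_eq B (Pi.single i 1)
    have hxy : ⟪x, y⟫ = B.repr x i := by
      conv_lhs => rw [← B.sum_repr x]
      rw [sum_inner]
      simp_rw [real_inner_smul_left, real_inner_comm, hy]
      simp [Pi.single_apply]
    rw [← hxy]
    refine hx y fun v hv => ?_
    obtain ⟨c, rfl⟩ := hgen v hv
    refine ⟨c i, ?_⟩
    rw [inner_sum]
    simp_rw [real_inner_smul_right, ← hB, hy]
    simp [Pi.single_apply]
  choose k hk using hcoord
  rw [← h.mem_toSubmodule, ← B.sum_repr x]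
  refine sum_mem fun i _ => ?_
  rw [hk, Int.cast_smul_eq_zsmul, hB]
  exact Submodule.smul_mem _ _ (h.mem_toSubmodule.2 (hbΛ i))

theorem IsBimodular.exists_isHalfDual {n : ℕ} {L : Set (EuclideanSpace ℝ (Fin n))}
    (hL : IsBimodular L) : ∃ w, IsHalfDual hL.1.toSubmodule w := by
  obtain ⟨hlat, w, ⟨hw, hwL⟩, hdual⟩ := hL
  refine ⟨w, hlat.2.2.2, hw, hdual, ?_⟩
  have h2 : w + w ∈ L := by
    refine (hdual (w + w) fun v hv => ?_).resolve_right (by simpa using hwL)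
    obtain ⟨k, hk⟩ := hw v hv
    exact ⟨k + k, by rw [inner_add_left, hk]; push_cast; rfl⟩
  obtain ⟨k, hk⟩ := hw _ h2
  rw [inner_add_right] at hk
  rcases Int.even_or_odd' k with ⟨c, rfl | rfl⟩
  · refine absurd (hlat.mem_of_dual_dual fun y hy => ?_) hwL
    rcases hdual y hy with hyL | hyL
    · exact hw y hyL
    · obtain ⟨l, hl⟩ := hw _ hyL
      refine ⟨l + c, ?_⟩
      rw [inner_sub_right] at hl
      push_cast at hk ⊢
      linarith
  · refine ⟨c, ?_⟩
    push_cast at hk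
    linarith

theorem IsLattice.mem_charSet {n : ℕ} {Λ : Set (EuclideanSpace ℝ (Fin n))} (h : IsLattice Λ)
    {ξ : EuclideanSpace ℝ (Fin n)} (hξ : ξ ∈ h.toSubmodule) (hc : IsCharOn h.toSubmodule ξ) :
    ξ ∈ CharSet Λ :=
  ⟨fun v hv => h.2.2.2 ξ hξ v hv, fun v hv => by
    rw [real_inner_comm]
    exact hc v hv⟩

theorem defectSign_le {n : ℕ} {Λ : Set (EuclideanSpace ℝ (Fin n))} {ε : ℤ}
    {ξ : EuclideanSpace ℝ (Fin n)} (hξ : ξ ∈ CharSign Λ ε) :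
    defectSign Λ ε ≤ (⟪ξ, ξ⟫ - (n : ℝ)) / 4 := by
  refine csInf_le ⟨-(n : ℝ) / 4, ?_⟩ ⟨ξ, hξ, rfl⟩
  rintro _ ⟨η, -, rfl⟩
  have : 0 ≤ ⟪η, η⟫ := real_inner_self_nonneg
  simp only
  linarith

/-- for every bimodular lattice `L`, `d_+(L) + d_−(L) ≤ 0`. -/
theorem stmt7 {n : ℕ} (L : Set (EuclideanSpace ℝ (Fin n))) (hL : IsBimodular L) :
    defectSign L 1 + defectSign L (-1) ≤ 0 := by
  obtain ⟨w, hw⟩ := hL.exists_isHalfDual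
  obtain ⟨ξ, hξ, η, hη, hcξ, hcη, ⟨k, hk⟩, ⟨l, hl⟩, hle⟩ := hw.exists_inner_self_add_le
  rw [finrank_euclideanSpace_fin] at hk hl hle
  have h1 := defectSign_le (ε := 1) ⟨hL.1.mem_charSet hξ hcξ, k, by rw [hk]; push_cast; ring⟩
  have h2 := defectSign_le (ε := -1) ⟨hL.1.mem_charSet hη hcη, l, by rw [hl]; push_cast; ring⟩
  linarith

end
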